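/- arXiv:2001.11058 — 4 statements merged into one kernel-verified Lean document; each statement's English description precedes it below -/
import Mathlib

section
/- If X ⊆ 2^ω is a Borel E₀-large set and f : X → 2^ω is a Borel map, then there exists a canonical E₀-large set Y ⊆ X such that the restriction f↾Y is either injective or constant. -/
open MeasureTheory

abbrev Cantor : Type := ℕ → Bool

/-- The equivalence relation `E₀`: eventual agreement. -/
def eZero (x y : Cantor) : Prop := {k | x k ≠ y k}.Finite

/-- The equivalence relation `Eₑ`: the set of disagreements is finite with even cardinality. -/
def eEven (x y : Cantor) : Prop := {k | x k ≠ y k}.Finite ∧ Even ({k | x k ≠ y k}.ncard)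

/-- A set is coanalytic (`Π¹₁`) iff its complement is analytic. -/
def IsCoanalytic {α : Type*} [TopologicalSpace α] (S : Set α) : Prop := AnalyticSet Sᶜ

/-- A perfect set: nonempty, closed, no isolated points. -/
def PerfectSet (X : Set Cantor) : Prop := Perfect X ∧ X.Nonempty

/-- `E` restricted to the Borel set `X` is smooth. -/
def RelSmoothOn (E : Cantor → Cantor → Prop) (X : Set Cantor) : Prop :=
  ∃ f : X → Cantor, Measurable f ∧ ∀ x y : X, (E x y ↔ f x = f y)

/-- A Borel set is `E₀`-large iff `E₀` restricted to it is not smooth. -/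
def E0Large (X : Set Cantor) : Prop := ¬ RelSmoothOn eZero X

/-- An `E₀`-array: strings `u n i` with equal positive lengths and `u n 0 ≠ u n 1`. -/
structure E0Array where
  u : ℕ → Bool → List Bool
  len_eq : ∀ n, (u n false).length = (u n true).length
  len_pos : ∀ n, 1 ≤ (u n false).length
  ne : ∀ n, u n false ≠ u n true

/-- The point `x_u^a = u 0 (a 0) ⌢ u 1 (a 1) ⌢ ⋯`. (Since every block has length
at least one, the join of the first `m+1` blocks has length `> m`.) -/
def xua (U : E0Array) (a : Cantor) : Cantor := fun m =>
  (((List.range (m + 1)).map (fun n => U.u n (a n))).flatten).getD m false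

/-- The canonical `E₀`-large set `D_u` determined by the array `u`. -/
def Du (U : E0Array) : Set Cantor := Set.range (xua U)

/-- A double-bubble system. -/
structure DBS (D E : Cantor → Cantor → Prop) : Prop where
  equivD : Equivalence D
  equivE : Equivalence E
  borelD : MeasurableSet {p : Cantor × Cantor | D p.1 p.2}
  borelE : MeasurableSet {p : Cantor × Cantor | E p.1 p.2}
  countableD : ∀ x, {y | D x y}.Countable
  countableE : ∀ x, {y | E x y}.Countable
  sub : ∀ x y, D x y → E x y
  double : ∀ x, ∃ y, E x y ∧ ¬ D x y ∧ ∀ z, E x z → (D x z ∨ D y z)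

/-- `⟨D,E⟩ ⊑ ⟨D',E'⟩`: extension of double-bubble systems. -/
def DBSle (D E D' E' : Cantor → Cantor → Prop) : Prop :=
  (∀ x y, D x y → D' x y) ∧ (∀ x y, E x y → E' x y) ∧
    (∀ x y, E x y → ¬ D x y → ¬ D' x y)


/-- Flip the values of `x` at the places in `F`. -/
def toggle (F : Finset ℕ) (x : Cantor) : Cantor := fun k => xor (x k) (decide (k ∈ F))

/-- `x` and `y` have the same values below `n`. -/
def Agree (n : ℕ) (x y : Cantor) : Prop := ∀ m < n, x m = y m

/-- The `n`-th block `[l n, l (n + 1))` of `φ a` is an injective function of `a n` alone. -/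
structure IsBlockMap (l : ℕ → ℕ) (φ : Cantor → Cantor) : Prop where
  mono : StrictMono l
  zero : l 0 = 0
  congr : ∀ n a b, a n = b n → ∀ m, l n ≤ m → m < l (n + 1) → φ a m = φ b m
  sep : ∀ n a b, a n ≠ b n → ∃ m, l n ≤ m ∧ m < l (n + 1) ∧ φ a m ≠ φ b m

/-- A set covered by countably many Borel partial transversals of `eZero`. -/
def IsSmall (A : Set Cantor) : Prop :=
  ∃ T : ℕ → Set Cantor, (∀ n, MeasurableSet (T n)) ∧
    (∀ n F x, x ∈ T n → toggle F x ∈ T n → toggle F x = x) ∧ A ⊆ ⋃ n, T n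

theorem toggle_empty (x : Cantor) : toggle ∅ x = x := by
  funext k; simp [toggle]

theorem toggle_symmDiff (s F : Finset ℕ) (x : Cantor) :
    toggle (symmDiff s F) x = toggle s (toggle F x) := by
  funext k
  by_cases h1 : k ∈ s <;> by_cases h2 : k ∈ F <;> simp [toggle, Finset.mem_symmDiff, h1, h2]

theorem toggle_toggle (F : Finset ℕ) (x : Cantor) : toggle F (toggle F x) = x := by
  rw [← toggle_symmDiff, symmDiff_self]; exact toggle_empty x

theorem measurable_toggle (F : Finset ℕ) : Measurable (toggle F) := by
  refine measurable_pi_lambda _ fun k => ?_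
  exact (measurable_of_finite (fun b : Bool => xor b (decide (k ∈ F)))).comp (measurable_pi_apply k)

theorem eZero_iff_exists_toggle (x y : Cantor) : eZero x y ↔ ∃ F, toggle F x = y := by
  constructor
  · intro h
    have h' : {k | x k ≠ y k}.Finite := h
    refine ⟨h'.toFinset, ?_⟩
    funext k
    simp only [toggle, Set.Finite.mem_toFinset, Set.mem_ofPred_eq]
    cases x k <;> cases y k <;> simp
  · rintro ⟨F, rfl⟩
    refine F.finite_toSet.subset fun k hk => ?_
    by_contra hkF
    have hkF' : k ∉ F := hkF
    exact hk (by simp [toggle, hkF'])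

theorem IsBlockMap.exists_block {l : ℕ → ℕ} (hl : StrictMono l) (h0 : l 0 = 0) (m : ℕ) :
    ∃ n, l n ≤ m ∧ m < l (n + 1) := by
  have hex : ∃ n, m < l (n + 1) := ⟨m, lt_of_lt_of_le (Nat.lt_succ_self m) (hl.id_le (m + 1))⟩
  refine ⟨Nat.find hex, ?_, Nat.find_spec hex⟩
  rcases h : Nat.find hex with _ | k
  · omega
  · have := Nat.find_min hex (m := k) (by omega)
    omega

theorem IsBlockMap.comp {l k : ℕ → ℕ} {φ ψ : Cantor → Cantor} (hφ : IsBlockMap l φ)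
    (hψ : IsBlockMap k ψ) : IsBlockMap (l ∘ k) (φ ∘ ψ) where
  mono := hφ.mono.comp hψ.mono
  zero := by simp [hψ.zero, hφ.zero]
  congr n a b hab m h1 h2 := by
    obtain ⟨j, hj1, hj2⟩ := IsBlockMap.exists_block hφ.mono hφ.zero m
    refine hφ.congr j _ _ (hψ.congr n a b hab j ?_ ?_) m hj1 hj2
    · have := hφ.mono.lt_iff_lt.1 (lt_of_le_of_lt h1 hj2)
      omega
    · exact hφ.mono.lt_iff_lt.1 (lt_of_le_of_lt hj1 h2)
  sep n a b hab := by
    obtain ⟨j, h1, h2, hj⟩ := hψ.sep n a b hab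
    obtain ⟨m, h3, h4, hm⟩ := hφ.sep j _ _ hj
    exact ⟨m, (hφ.mono.monotone h1).trans h3,
      h4.trans_le (hφ.mono.monotone h2), hm⟩

theorem IsBlockMap.exists_array {l : ℕ → ℕ} {φ : Cantor → Cantor} (hφ : IsBlockMap l φ) :
    ∃ U : E0Array, xua U = φ := by
  have hlt (n : ℕ) : l n < l (n + 1) := hφ.mono (Nat.lt_succ_self n)
  let U : E0Array :=
    { u := fun n i => (List.range' (l n) (l (n + 1) - l n)).map (φ fun _ => i)
      len_eq := fun n => by simp
      len_pos := fun n => by have := hlt n; simp; omega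
      ne := fun n h => by
        obtain ⟨m, h1, h2, hm⟩ := hφ.sep n (fun _ => false) (fun _ => true) (by simp)
        refine hm (List.map_inj_left.1 h m ?_)
        rw [List.mem_range'_1]; omega }
  refine ⟨U, ?_⟩
  funext a m
  have key (n : ℕ) : ((List.range n).map (fun n => U.u n (a n))).flatten
      = (List.range (l n)).map (φ a) := by
    induction n with
    | zero => simp [hφ.zero]
    | succ n ih =>
      have hb : U.u n (a n) = (List.range' (l n) (l (n + 1) - l n)).map (φ a) := by
        refine List.map_inj_left.2 fun m hm => ?_
        rw [List.mem_range'_1] at hm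
        exact hφ.congr n (fun _ => a n) a rfl m hm.1 (by omega)
      have hr : List.range (l (n + 1)) =
          List.range (l n) ++ List.range' (l n) (l (n + 1) - l n) := by
        have := hlt n
        rw [List.range_eq_range', List.range_eq_range']
        have h := List.range'_append_1 (s := 0) (m := l n) (n := l (n + 1) - l n)
        rw [zero_add] at h
        rw [h]; congr 1; omega
      rw [List.range_succ, List.map_append, List.flatten_append, ih, hr, List.map_append]
      simp [hb]
  have hm : m < l (m + 1) := lt_of_lt_of_le (Nat.lt_succ_self m) (hφ.mono.id_le (m + 1))
  unfold xua
  rw [key]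
  simp [List.getD_eq_getElem?_getD, hm]

theorem exists_isBlockMap {l : ℕ → ℕ} (hl : StrictMono l) (h0 : l 0 = 0) (u : ℕ → Bool → Cantor)
    (hu : ∀ n, ∃ m, l n ≤ m ∧ m < l (n + 1) ∧ u n false m ≠ u n true m) :
    ∃ φ, IsBlockMap l φ ∧ ∀ n a m, l n ≤ m → m < l (n + 1) → φ a m = u n (a n) m := by
  choose idx h1 h2 using IsBlockMap.exists_block hl h0
  have key : ∀ n (a : Cantor) m, l n ≤ m → m < l (n + 1) →
      u (idx m) (a (idx m)) m = u n (a n) m := by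
    intro n a m h3 h4
    have h5 := hl.lt_iff_lt.1 ((h1 m).trans_lt h4)
    have h6 := hl.lt_iff_lt.1 (h3.trans_lt (h2 m))
    have : idx m = n := by omega
    rw [this]
  refine ⟨fun a m => u (idx m) (a (idx m)) m, ⟨hl, h0, ?_, ?_⟩, key⟩
  · intro n a b hab m h3 h4
    rw [key n a m h3 h4, key n b m h3 h4, hab]
  · intro n a b hab
    obtain ⟨m, h3, h4, hm⟩ := hu n
    refine ⟨m, h3, h4, ?_⟩
    rw [key n a m h3 h4, key n b m h3 h4]
    rcases ha : a n <;> rcases hb : b n <;> rw [ha, hb] at hab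
    · exact absurd rfl hab
    · exact hm
    · exact hm.symm
    · exact absurd rfl hab

theorem IsBlockMap.agree {l : ℕ → ℕ} {φ : Cantor → Cantor} (hφ : IsBlockMap l φ) {n : ℕ}
    {a b : Cantor} (h : Agree n a b) : Agree (l n) (φ a) (φ b) := by
  intro m hm
  obtain ⟨j, h1, h2⟩ := IsBlockMap.exists_block hφ.mono hφ.zero m
  exact hφ.congr j a b (h j (hφ.mono.lt_iff_lt.1 (h1.trans_lt hm))) m h1 h2

theorem isBlockMap_append (n : ℕ) (p : Cantor) :
    ∃ l φ, IsBlockMap l φ ∧ ∀ a, Agree n (φ a) p := by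
  let l : ℕ → ℕ := fun k => if k = 0 then 0 else n + k
  have hl : StrictMono l := by
    refine strictMono_nat_of_lt_succ fun k => ?_
    by_cases hk : k = 0 <;> simp [l, hk]
  obtain ⟨φ, hφ, h⟩ := exists_isBlockMap hl (by simp [l])
    (fun _ i m => if m < n then p m else i)
    (fun k => ⟨n + k, by by_cases hk : k = 0 <;> simp [l, hk], by simp [l], by simp⟩)
  refine ⟨l, φ, hφ, fun a m hm => ?_⟩
  rw [h 0 a m (by simp [l]) (by simp [l]; omega)]
  simp [hm]

theorem exists_separating_block {g : Cantor → Cantor}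
    (hg : ∀ n, ∃ N, ∀ a b, Agree N a b → Agree n (g a) (g b))
    (hne : ∀ n p, ∃ x y, Agree n x p ∧ Agree n y p ∧ g x ≠ g y) (l : ℕ) (S : Finset Cantor) :
    ∃ (l' : ℕ) (u : Bool → Cantor), (∃ m, l ≤ m ∧ m < l' ∧ u false m ≠ u true m) ∧
      ∀ p ∈ S, ∀ x y, Agree l x p → Agree l y p →
        (∀ m, l ≤ m → m < l' → x m = u false m) → (∀ m, l ≤ m → m < l' → y m = u true m) →
        g x ≠ g y := by
  classical
  induction S using Finset.induction_on with
  | empty => exact ⟨l + 1, fun i _ => i, ⟨l, by simp⟩, by simp⟩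
  | insert p S _ ih =>
    obtain ⟨l', u, ⟨m, h1, h2, hm⟩, hS⟩ := ih
    obtain ⟨x₁, x₂, hx₁, hx₂, hx⟩ := hne l' (fun m => if m < l then p m else u false m)
    obtain ⟨k, hk⟩ := Function.ne_iff.1 hx
    let y : Cantor := fun m => if m < l then p m else u true m
    obtain ⟨x, hx, hxy⟩ : ∃ x, Agree l' x (fun m => if m < l then p m else u false m) ∧
        g x k ≠ g y k := by
      by_cases h : g x₁ k = g y k
      · exact ⟨x₂, hx₂, fun h' => hk (h.trans h'.symm)⟩
      · exact ⟨x₁, hx₁, h⟩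
    obtain ⟨N, hN⟩ := hg (k + 1)
    have hxu : ∀ m, l ≤ m → m < l' → x m = u false m := fun m h3 h4 => by
      rw [hx m h4]; exact if_neg (by omega)
    have hyu : ∀ m, l ≤ m → y m = u true m := fun m h3 => if_neg (by omega)
    refine ⟨max l' N, fun i => if i then y else x, ⟨m, h1, by omega, ?_⟩, ?_⟩
    · simpa [hxu m h1 h2, hyu m h1] using hm
    · simp only [Bool.false_eq_true, if_false, if_true]
      intro q hq x' y' hx' hy' hxx hyy
      rcases Finset.mem_insert.1 hq with rfl | hq
      · have e1 : Agree N x' x := fun m hm => by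
          by_cases h : m < l
          · rw [hx' m h, hx m (by omega)]; exact (if_pos h).symm
          · exact hxx m (by omega) (by omega)
        have e2 : Agree N y' y := fun m hm => by
          by_cases h : m < l
          · rw [hy' m h]; simp [y, h]
          · exact hyy m (by omega) (by omega)
        intro he
        apply hxy
        rw [← hN _ _ e1 k (by omega), ← hN _ _ e2 k (by omega), he]
      · exact hS q hq x' y' hx' hy'
          (fun m h3 h4 => by rw [hxx m h3 (by omega), hxu m h3 h4])
          (fun m h3 h4 => by rw [hyy m h3 (by omega), hyu m h3])

theorem exists_isBlockMap_injective {g : Cantor → Cantor}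
    (hg : ∀ n, ∃ N, ∀ a b, Agree N a b → Agree n (g a) (g b))
    (hne : ∀ n p, ∃ x y, Agree n x p ∧ Agree n y p ∧ g x ≠ g y) :
    ∃ l φ, IsBlockMap l φ ∧ Function.Injective (g ∘ φ) := by
  classical
  choose L u hu hsep using exists_separating_block hg hne
  let st : ℕ → ℕ × Finset Cantor := fun n => Nat.rec (0, {fun _ => false})
    (fun _ s => (L s.1 s.2, s.2.biUnion fun p => Finset.univ.image
      fun i m => if m < s.1 then p m else u s.1 s.2 i m)) n
  let l n := (st n).1
  have hl : StrictMono l := strictMono_nat_of_lt_succ fun n => by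
    obtain ⟨m, h1, h2, -⟩ := hu (st n).1 (st n).2
    exact h1.trans_lt h2
  obtain ⟨φ, hφ, h⟩ := exists_isBlockMap hl rfl (fun n => u (st n).1 (st n).2)
    (fun n => hu (st n).1 (st n).2)
  have hmem (a : Cantor) (n : ℕ) : ∃ p ∈ (st n).2, Agree (l n) (φ a) p := by
    induction n with
    | zero => exact ⟨_, Finset.mem_singleton_self _, fun m hm => absurd hm (Nat.not_lt_zero m)⟩
    | succ n ih =>
      obtain ⟨p, hp, hpa⟩ := ih
      refine ⟨fun m => if m < l n then p m else u (st n).1 (st n).2 (a n) m,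
        Finset.mem_biUnion.2 ⟨p, hp, Finset.mem_image.2 ⟨a n, Finset.mem_univ _, rfl⟩⟩,
        fun m hm => ?_⟩
      by_cases hml : m < l n
      · simp [hml, hpa m hml]
      · simp [hml, h n a m (not_lt.1 hml) hm]
  have main (n : ℕ) (a b : Cantor) (hab : Agree n a b) (ha : a n = false) (hb : b n = true) :
      g (φ a) ≠ g (φ b) := by
    obtain ⟨p, hp, hpa⟩ := hmem a n
    refine hsep (st n).1 (st n).2 p hp (φ a) (φ b) hpa (fun m hm => ?_) (fun m h1 h2 => ?_)
      (fun m h1 h2 => ?_)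
    · rw [← hφ.agree hab m hm]; exact hpa m hm
    · rw [← ha]; exact h n a m h1 h2
    · rw [← hb]; exact h n b m h1 h2
  refine ⟨l, φ, hφ, fun a b hab => ?_⟩
  by_contra hne'
  have hex := Function.ne_iff.1 hne'
  have hag : Agree (Nat.find hex) a b := fun m hm => by
    simpa using Nat.find_min hex hm
  have hn := Nat.find_spec hex
  rcases ha : a (Nat.find hex) <;> rcases hb : b (Nat.find hex) <;> rw [ha, hb] at hn
  · exact hn rfl
  · exact main _ a b hag ha hb hab
  · exact main _ b a (fun m hm => (hag m hm).symm) hb ha hab.symm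
  · exact hn rfl

theorem IsSmall.iUnion {ι : Type*} [Countable ι] {A : ι → Set Cantor} (h : ∀ i, IsSmall (A i)) :
    IsSmall (⋃ i, A i) := by
  choose T hT1 hT2 hT3 using h
  rcases isEmpty_or_nonempty ι with hι | hι
  · exact ⟨fun _ => ∅, by simp, by simp, by simp⟩
  · obtain ⟨e, he⟩ := exists_surjective_nat (ι × ℕ)
    refine ⟨fun n => T (e n).1 (e n).2, fun n => hT1 _ _, fun n => hT2 _ _, ?_⟩
    refine Set.iUnion_subset fun i x hx => ?_
    obtain ⟨k, hk⟩ := Set.mem_iUnion.1 (hT3 i hx)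
    obtain ⟨n, hn⟩ := he (i, k)
    exact Set.mem_iUnion.2 ⟨n, by simpa [hn] using hk⟩

theorem IsSmall.mono {A B : Set Cantor} (h : IsSmall B) (hAB : A ⊆ B) : IsSmall A := by
  obtain ⟨T, h1, h2, h3⟩ := h
  exact ⟨T, h1, h2, hAB.trans h3⟩

theorem nonempty_of_not_isSmall {A : Set Cantor} (h : ¬ IsSmall A) : A.Nonempty := by
  rw [Set.nonempty_iff_ne_empty]
  rintro rfl
  exact h ⟨fun _ => ∅, by simp, by simp, by simp⟩

theorem IsSmall.relSmoothOn {X : Set Cantor} (h : IsSmall X) : RelSmoothOn eZero X := by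
  classical
  obtain ⟨T, hT, hT2, hX⟩ := h
  have hsat (B : Set Cantor) (hB : MeasurableSet B) : MeasurableSet {x | ∃ F, toggle F x ∈ B} := by
    have : {x | ∃ F, toggle F x ∈ B} = ⋃ F, toggle F ⁻¹' B := by ext; simp
    rw [this]
    exact MeasurableSet.iUnion fun F => measurable_toggle F hB
  have hex (x : X) : ∃ n, ∃ F, toggle F x ∈ T n := by
    obtain ⟨n, hn⟩ := Set.mem_iUnion.1 (hX x.2)
    exact ⟨n, ∅, by rwa [toggle_empty]⟩
  let N (x : X) : ℕ := Nat.find (hex x)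
  choose G hG using fun x : X => Nat.find_spec (hex x)
  let r (x : X) : Cantor := toggle (G x) x
  have huniq (x : X) (F : Finset ℕ) (hF : toggle F x ∈ T (N x)) : toggle F x = r x := by
    have e : toggle (symmDiff F (G x)) (r x) = toggle F x := by
      rw [toggle_symmDiff]
      simp only [r]
      rw [toggle_toggle]
    rw [← e]
    exact hT2 (N x) _ _ (hG x) (e ▸ hF)
  have hN (x y : X) (F : Finset ℕ) (hF : toggle F x = y) : N x = N y := by
    have hF' : toggle F y = x := by rw [← hF, toggle_toggle]
    refine le_antisymm (Nat.find_min' _ ⟨symmDiff (G y) F, ?_⟩)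
      (Nat.find_min' _ ⟨symmDiff (G x) F, ?_⟩)
    · rw [toggle_symmDiff, hF]; exact hG y
    · rw [toggle_symmDiff, hF']; exact hG x
  refine ⟨r, fun B hB => ?_, fun x y => ⟨fun h => ?_, fun h => ?_⟩⟩
  · have : r ⁻¹' B = Subtype.val ⁻¹' ⋃ n, ({x | ∃ F, toggle F x ∈ T n ∩ B} ∩
        ⋂ m ∈ Set.Iio n, {x | ∃ F, toggle F x ∈ T m}ᶜ) := by
      ext x
      simp only [Set.mem_preimage, Set.mem_iUnion, Set.mem_inter_iff, Set.mem_iInter,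
        Set.mem_Iio, Set.mem_compl_iff, Set.mem_ofPred_eq]
      constructor
      · intro hx
        exact ⟨N x, ⟨G x, hG x, hx⟩, fun m hm => Nat.find_min (hex x) hm⟩
      · rintro ⟨n, ⟨F, hF, hFB⟩, hmin⟩
        have hn : N x = n := (Nat.find_eq_iff (hex x)).2 ⟨⟨F, hF⟩, hmin⟩
        rwa [← huniq x F (hn ▸ hF)]
    rw [this]
    refine measurable_subtype_coe (MeasurableSet.iUnion fun n =>
      (hsat _ ((hT n).inter hB)).inter
        (MeasurableSet.biInter (Set.to_countable _) fun m _ => (hsat _ (hT m)).compl))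
  · obtain ⟨F, hF⟩ := (eZero_iff_exists_toggle _ _).1 h
    have e : toggle (symmDiff (G y) F) x = r y := by rw [toggle_symmDiff, hF]
    rw [← e]
    refine (huniq x _ ?_).symm
    rw [e, hN x y F hF]
    exact hG y
  · refine (eZero_iff_exists_toggle _ _).2 ⟨symmDiff (G y) (G x), ?_⟩
    rw [toggle_symmDiff]
    change toggle (G y) (r x) = y
    rw [h]
    exact toggle_toggle _ _

theorem exists_toggle_not_isSmall {Y : Set Cantor} (hY : MeasurableSet Y) (hs : ¬ IsSmall Y) :
    ∃ F : Finset ℕ, F.Nonempty ∧ ¬ IsSmall (Y ∩ toggle F ⁻¹' Y) := by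
  by_contra! hcon
  let A (F : {F : Finset ℕ // F.Nonempty}) : Set Cantor := Y ∩ toggle F.1 ⁻¹' Y
  have hA : MeasurableSet (⋃ F, A F) :=
    MeasurableSet.iUnion fun F => hY.inter (measurable_toggle F.1 hY)
  have h1 : IsSmall (⋃ F, A F) := IsSmall.iUnion fun F => hcon F.1 F.2
  have h2 : IsSmall (Y \ ⋃ F, A F) := by
    refine ⟨fun _ => Y \ ⋃ F, A F, fun _ => hY.diff hA, fun _ F x hx hFx => ?_,
      Set.subset_iUnion (fun _ : ℕ => Y \ ⋃ F, A F) 0⟩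
    rcases F.eq_empty_or_nonempty with rfl | hF
    · exact toggle_empty x
    · exact (hx.2 (Set.mem_iUnion.2 ⟨⟨F, hF⟩, hx.1, hFx.1⟩)).elim
  refine hs ((IsSmall.iUnion (A := fun b : Bool => if b then ⋃ F, A F else Y \ ⋃ F, A F)
    (by simp [h1, h2])).mono fun x hx => ?_)
  by_cases hxA : x ∈ ⋃ F, A F
  · exact Set.mem_iUnion.2 ⟨true, by simpa using hxA⟩
  · exact Set.mem_iUnion.2 ⟨false, by simpa using ⟨hx, by simpa using hxA⟩⟩

theorem exists_subset_not_isSmall {ι : Type*} [Countable ι] {C : ι → Set Cantor}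
    (hC : ∀ i, MeasurableSet (C i)) (hcov : ∀ x, ∃ i, x ∈ C i) {Y : Set Cantor}
    (hY : MeasurableSet Y) (hs : ¬ IsSmall Y) (S : Finset (Finset ℕ)) :
    ∃ Z ⊆ Y, MeasurableSet Z ∧ ¬ IsSmall Z ∧ ∀ s ∈ S, ∃ i, ∀ z ∈ Z, toggle s z ∈ C i := by
  classical
  induction S using Finset.induction_on with
  | empty => exact ⟨Y, subset_rfl, hY, hs, by simp⟩
  | insert s S _ ih =>
    obtain ⟨Z, hZY, hZ, hZs, hZC⟩ := ih
    obtain ⟨i, hi⟩ : ∃ i, ¬ IsSmall (Z ∩ toggle s ⁻¹' C i) := by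
      by_contra! hcon
      refine hZs ((IsSmall.iUnion hcon).mono fun x hx => ?_)
      obtain ⟨i, hi⟩ := hcov (toggle s x)
      exact Set.mem_iUnion.2 ⟨i, hx, hi⟩
    refine ⟨_, Set.inter_subset_left.trans hZY, hZ.inter (measurable_toggle s (hC i)), hi, ?_⟩
    intro t ht
    rcases Finset.mem_insert.1 ht with rfl | ht
    · exact ⟨i, fun z hz => hz.2⟩
    · obtain ⟨j, hj⟩ := hZC t ht
      exact ⟨j, fun z hz => hj z hz.1⟩

theorem measurableSet_filter_range_eq (n : ℕ) (F : Finset ℕ) :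
    MeasurableSet {x : Cantor | (Finset.range n).filter (fun k => x k = true) = F} := by
  have : {x : Cantor | (Finset.range n).filter (fun k => x k = true) = F}
      = ⋂ k, {x : Cantor | (k ∈ Finset.range n ∧ x k = true) ↔ k ∈ F} := by
    ext x
    simp [Finset.ext_iff]
  rw [this]
  exact MeasurableSet.iInter fun k =>
    measurable_pi_apply (X := fun _ : ℕ => Bool) k
      (MeasurableSet.of_discrete (s := {b : Bool | (k ∈ Finset.range n ∧ b = true) ↔ k ∈ F}))

theorem agree_of_filter_range_eq {n : ℕ} {x y : Cantor}
    (h : (Finset.range n).filter (fun k => x k = true)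
      = (Finset.range n).filter (fun k => y k = true)) : Agree n x y := by
  intro m hm
  have := Finset.ext_iff.1 h m
  simp only [Finset.mem_filter, Finset.mem_range, hm, true_and] at this
  exact Bool.eq_iff_iff.2 this

theorem continuous_comp_and_isClosed_preimage {P : Type*} [TopologicalSpace P] {π : P → Cantor}
    {f : Cantor → Cantor} {X : Set Cantor} [DecidablePred (· ∈ X)]
    (h : Continuous fun p => (decide (π p ∈ X), f (π p))) :
    Continuous (f ∘ π) ∧ IsClosed (π ⁻¹' X) := by
  refine ⟨continuous_snd.comp h, ?_⟩
  have : π ⁻¹' X = (fun p => (decide (π p ∈ X), f (π p))) ⁻¹' (Prod.fst ⁻¹' {true}) := by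
    ext; simp
  rw [this]
  exact ((isClosed_discrete _).preimage continuous_fst).preimage h

theorem exists_polish_refinement {X : Set Cantor} (hX : MeasurableSet X) {f : Cantor → Cantor}
    (hf : Measurable f) :
    ∃ (P : Type) (_ : TopologicalSpace P) (_ : PolishSpace P) (π : P → Cantor),
      Continuous π ∧ Function.Bijective π ∧ Continuous (f ∘ π) ∧ IsClosed (π ⁻¹' X) := by
  classical
  have hF : Measurable (fun x : Cantor => (decide (x ∈ X), f x)) :=
    (measurable_to_bool (by
      have : (fun x : Cantor => decide (x ∈ X)) ⁻¹' {true} = X := by ext; simp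
      rw [this]; exact hX)).prodMk hf
  have : PolishSpace Bool := {}
  obtain ⟨t, ht, hcont, hpol⟩ := hF.exists_continuous
  exact ⟨Cantor, t, hpol, id, continuous_id_iff_le.2 ht, Function.bijective_id,
    @continuous_comp_and_isClosed_preimage Cantor t id f X _ hcont⟩

open Filter Topology in
theorem exists_countable_covers {X : Set Cantor} (hX : MeasurableSet X) {f : Cantor → Cantor}
    (hf : Measurable f) :
    ∃ C : ℕ → ℕ × Finset ℕ → Set Cantor, (∀ n i, MeasurableSet (C n i)) ∧
      (∀ n x, ∃ i, x ∈ C n i) ∧ (∀ n i, ∀ x ∈ C n i, ∀ y ∈ C n i, Agree n (f x) (f y)) ∧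
      ∀ (i : ℕ → ℕ × Finset ℕ) (y : ℕ → Cantor), (∀ n, y n ∈ X) →
        (∀ n, ∀ k ≤ n, y n ∈ C k (i k)) →
        ∃ z ∈ X, Tendsto y atTop (𝓝 z) ∧ Tendsto (fun n => f (y n)) atTop (𝓝 (f z)) := by
  obtain ⟨P, _, _, π, hπ, hbij, hfπ, hcl⟩ := exists_polish_refinement hX hf
  let := TopologicalSpace.upgradeIsCompletelyMetrizable P
  borelize P
  have hemb := hπ.measurableEmbedding hbij.1
  have : Nonempty P := ⟨(hbij.2 fun _ => false).choose⟩
  refine ⟨fun n i => π '' Metric.ball (TopologicalSpace.denseSeq P i.1) (1 / ((n : ℝ) + 1)) ∩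
    f ⁻¹' {x | (Finset.range n).filter (fun k => x k = true) = i.2}, ?_, ?_, ?_, ?_⟩
  · exact fun n i => (hemb.measurableSet_image.2 Metric.isOpen_ball.measurableSet).inter
      (hf (measurableSet_filter_range_eq n i.2))
  · intro n x
    obtain ⟨p, rfl⟩ := hbij.2 x
    obtain ⟨j, hj⟩ := (TopologicalSpace.denseRange_denseSeq P).exists_dist_lt p
      (Nat.one_div_pos_of_nat (α := ℝ) (n := n))
    exact ⟨(j, _), ⟨p, hj, rfl⟩, rfl⟩
  · intro n i x hx y hy
    exact agree_of_filter_range_eq (Eq.trans hx.2 (Eq.symm hy.2))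
  · intro i y hyX hy
    choose q hq using fun n => hbij.2 (y n)
    have hball : ∀ k n, k ≤ n →
        dist (q n) (TopologicalSpace.denseSeq P (i k).1) < 1 / ((k : ℝ) + 1) := by
      intro k n hkn
      obtain ⟨⟨p, hp, hpy⟩, -⟩ := hy n k hkn
      rw [← hq n] at hpy
      rw [← hbij.1 hpy]
      exact hp
    have hcauchy : CauchySeq q := by
      refine Metric.cauchySeq_iff'.2 fun ε hε => ?_
      obtain ⟨k, hk⟩ := exists_nat_one_div_lt (half_pos hε)
      refine ⟨k, fun n hn => ?_⟩
      have h1 := hball k n hn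
      have h2 := hball k k le_rfl
      have h3 := dist_triangle_right (q n) (q k) (TopologicalSpace.denseSeq P (i k).1)
      linarith
    obtain ⟨z, hz⟩ := cauchySeq_tendsto_of_complete hcauchy
    refine ⟨π z, hcl.mem_of_tendsto hz (Eventually.of_forall fun n => ?_), ?_, ?_⟩
    · simpa [hq n] using hyX n
    · simpa [Function.comp_def, hq] using (hπ.tendsto z).comp hz
    · simpa [Function.comp_def, hq] using (hfπ.tendsto z).comp hz

/-- A large set `Y` whose translates by the members of `S` lie in `X`. -/
structure FusionStage (X : Set Cantor) where
  l : ℕ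
  S : Finset (Finset ℕ)
  Y : Set Cantor
  measurable : MeasurableSet Y
  large : ¬ IsSmall Y
  agree : ∀ x ∈ Y, ∀ y ∈ Y, Agree l x y
  mem : ∀ s ∈ S, ∀ y ∈ Y, toggle s y ∈ X
  lt : ∀ s ∈ S, ∀ k ∈ s, k < l

theorem FusionStage.exists_next {X : Set Cantor} (σ : FusionStage X) {ι : Type*} [Countable ι]
    {C : ι → Set Cantor} (hC : ∀ i, MeasurableSet (C i)) (hcov : ∀ x, ∃ i, x ∈ C i) :
    ∃ (τ : FusionStage X) (F : Finset ℕ), F.Nonempty ∧ (∀ k ∈ F, σ.l ≤ k ∧ k < τ.l) ∧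
      τ.Y ⊆ σ.Y ∧ (∀ y ∈ τ.Y, toggle F y ∈ σ.Y) ∧
      (∀ s ∈ σ.S, s ∈ τ.S ∧ symmDiff s F ∈ τ.S) ∧
      ∀ s ∈ τ.S, ∃ i, ∀ y ∈ τ.Y, toggle s y ∈ C i := by
  classical
  obtain ⟨F, hF, hlarge⟩ := exists_toggle_not_isSmall σ.measurable σ.large
  have hYF := σ.measurable.inter (measurable_toggle F σ.measurable)
  let l' := max (σ.l + 1) (F.sup id + 1)
  have hFl' : ∀ k ∈ F, k < l' := fun k hk => by
    have : k ≤ F.sup id := Finset.le_sup (f := id) hk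
    omega
  obtain ⟨Z₁, hZ₁, hm₁, hs₁, hc₁⟩ := exists_subset_not_isSmall
    (fun G => measurableSet_filter_range_eq l' G) (fun x => ⟨_, rfl⟩) hYF hlarge {∅}
  let S' := σ.S ∪ σ.S.image fun s => symmDiff s F
  obtain ⟨Z, hZ, hm, hs, hc⟩ := exists_subset_not_isSmall hC hcov hm₁ hs₁ S'
  have hFl : ∀ k ∈ F, σ.l ≤ k := by
    intro k hk
    by_contra! hlt
    obtain ⟨x, hx⟩ := nonempty_of_not_isSmall hs
    have := σ.agree x (hZ₁ (hZ hx)).1 _ (hZ₁ (hZ hx)).2 k hlt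
    simp [toggle, hk] at this
  refine ⟨⟨l', S', Z, hm, hs, ?_, ?_, ?_⟩, F, hF, fun k hk => ⟨hFl k hk, hFl' k hk⟩,
    fun y hy => (hZ₁ (hZ hy)).1, fun y hy => (hZ₁ (hZ hy)).2, fun s hs => ⟨?_, ?_⟩, hc⟩
  · intro x hx y hy
    obtain ⟨G, hG⟩ := hc₁ ∅ (by simp)
    have h1 := hG x (hZ hx)
    have h2 := hG y (hZ hy)
    rw [toggle_empty] at h1 h2
    exact agree_of_filter_range_eq (Eq.trans h1 (Eq.symm h2))
  · intro s hs y hy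
    rcases Finset.mem_union.1 hs with hs | hs
    · exact σ.mem s hs y (hZ₁ (hZ hy)).1
    · obtain ⟨s, hsS, rfl⟩ := Finset.mem_image.1 hs
      rw [toggle_symmDiff]
      exact σ.mem s hsS _ (hZ₁ (hZ hy)).2
  · intro s hs k hk
    have hσ : σ.l < l' := by omega
    rcases Finset.mem_union.1 hs with hs | hs
    · exact (σ.lt s hs k hk).trans hσ
    · obtain ⟨s, hsS, rfl⟩ := Finset.mem_image.1 hs
      rcases Finset.mem_symmDiff.1 hk with hk | hk
      · exact (σ.lt s hsS k hk.1).trans hσ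
      · exact hFl' k hk.1
  · exact Finset.mem_union_left _ hs
  · exact Finset.mem_union_right _ (Finset.mem_image_of_mem _ hs)

open Filter Topology in
theorem exists_isBlockMap_subset {X : Set Cantor} (hX : MeasurableSet X) (hXs : ¬ IsSmall X)
    {f : Cantor → Cantor} (hf : Measurable f) :
    ∃ l φ, IsBlockMap l φ ∧ (∀ a, φ a ∈ X) ∧
      ∀ n, ∃ N, ∀ a b, Agree N a b → Agree n (f (φ a)) (f (φ b)) := by
  obtain ⟨C, hC, hcov, hCf, hlim⟩ := exists_countable_covers hX hf
  choose next F hF hFl hYY hFY hSS hSC using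
    fun (σ : FusionStage X) (n : ℕ) => σ.exists_next (hC n) (hcov n)
  let st : ℕ → FusionStage X := fun n => Nat.rec
    ⟨0, {∅}, X, hX, hXs, fun _ _ _ _ m hm => absurd hm (Nat.not_lt_zero m),
      by simp [toggle_empty], by simp⟩ (fun n σ => next σ n) n
  let G n := F (st n) n
  let l n := (st n).l
  have hl : StrictMono l := strictMono_nat_of_lt_succ fun n => by
    obtain ⟨k, hk⟩ := hF (st n) n
    exact (hFl (st n) n k hk).1.trans_lt (hFl (st n) n k hk).2
  choose x hx using fun n => nonempty_of_not_isSmall (st n).large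
  let s : Cantor → ℕ → Finset ℕ := fun a n => Nat.rec ∅
    (fun n t => if a n then symmDiff t (G n) else t) n
  have hs_succ (a : Cantor) (n : ℕ) :
      s a (n + 1) = if a n then symmDiff (s a n) (G n) else s a n := rfl
  have hsS (a : Cantor) (n : ℕ) : s a n ∈ (st n).S := by
    induction n with
    | zero => exact Finset.mem_singleton_self _
    | succ n ih =>
      rw [hs_succ]
      split_ifs
      · exact (hSS (st n) n _ ih).2
      · exact (hSS (st n) n _ ih).1
  have hback (a : Cantor) (n : ℕ) : ∀ y ∈ (st (n + 1)).Y, ∃ y' ∈ (st n).Y,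
      toggle (s a (n + 1)) y = toggle (s a n) y' := by
    intro y hy
    rw [hs_succ]
    split_ifs
    · exact ⟨_, hFY (st n) n y hy, toggle_symmDiff _ _ _⟩
    · exact ⟨y, hYY (st n) n hy, rfl⟩
  have hback' (a : Cantor) {k n : ℕ} (hkn : k ≤ n) : ∀ y ∈ (st n).Y, ∃ y' ∈ (st k).Y,
      toggle (s a n) y = toggle (s a k) y' := by
    induction n, hkn using Nat.le_induction with
    | base => exact fun y hy => ⟨y, hy, rfl⟩
    | succ n _ ih =>
      intro y hy
      obtain ⟨y', hy', e⟩ := hback a n y hy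
      obtain ⟨y'', hy'', e'⟩ := ih y' hy'
      exact ⟨y'', hy'', e.trans e'⟩
  let u : ℕ → Bool → Cantor := fun n i =>
    if i then toggle (G n) (x (n + 1)) else x (n + 1)
  obtain ⟨φ, hφ, hφu⟩ := exists_isBlockMap hl rfl u (fun n => by
    obtain ⟨k, hk⟩ := hF (st n) n
    refine ⟨k, (hFl (st n) n k hk).1, (hFl (st n) n k hk).2, ?_⟩
    have hk' : k ∈ G n := hk
    simp [u, toggle, hk'])
  have hφs (a : Cantor) (n : ℕ) : ∀ y ∈ (st n).Y, Agree (l n) (φ a) (toggle (s a n) y) := by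
    induction n with
    | zero => exact fun _ _ m hm => absurd hm (Nat.not_lt_zero m)
    | succ n ih =>
      intro y hy m hm
      by_cases hml : m < l n
      · obtain ⟨y', hy', e⟩ := hback a n y hy
        rw [e]
        exact ih y' hy' m hml
      · rw [hφu n a m (not_lt.1 hml) hm]
        have hms : m ∉ s a n := fun h => hml ((st n).lt _ (hsS a n) m h)
        have hxy : x (n + 1) m = y m := (st (n + 1)).agree _ (hx (n + 1)) _ hy m hm
        rw [hs_succ]
        cases a n <;> simp [u, toggle, Finset.mem_symmDiff, hms, hxy]
  choose i hi using fun n (t : {t // t ∈ (st (n + 1)).S}) => hSC (st n) n t.1 t.2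
  let y : Cantor → ℕ → Cantor := fun a n => toggle (s a (n + 1)) (x (n + 1))
  have hyC (a : Cantor) {k n : ℕ} (hkn : k ≤ n) : y a n ∈ C k (i k ⟨_, hsS a (k + 1)⟩) := by
    obtain ⟨y', hy', e⟩ := hback' a (Nat.succ_le_succ hkn) _ (hx (n + 1))
    change toggle _ _ ∈ _
    rw [e]
    exact hi k ⟨_, hsS a (k + 1)⟩ y' hy'
  have hconv (a : Cantor) : φ a ∈ X ∧ Tendsto (fun n => f (y a n)) atTop (𝓝 (f (φ a))) := by
    obtain ⟨z, hz, h1, h2⟩ := hlim (fun k => i k ⟨_, hsS a (k + 1)⟩) (y a)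
      (fun n => (st (n + 1)).mem _ (hsS a (n + 1)) _ (hx (n + 1))) (fun n k hk => hyC a hk)
    have : φ a = z := by
      refine tendsto_nhds_unique (tendsto_pi_nhds.2 fun m => ?_) h1
      refine tendsto_const_nhds.congr' ?_
      filter_upwards [eventually_ge_atTop m] with n hn
      refine hφs a (n + 1) _ (hx (n + 1)) m ?_
      exact lt_of_lt_of_le (Nat.lt_succ_of_le hn) (hl.id_le (n + 1))
    rw [this]
    exact ⟨hz, h2⟩
  refine ⟨l, φ, hφ, fun a => (hconv a).1, fun n => ⟨n + 1, fun a b hab m hm => ?_⟩⟩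
  have hsab : s a (n + 1) = s b (n + 1) := by
    have : ∀ k ≤ n + 1, s a k = s b k := by
      intro k
      induction k with
      | zero => exact fun _ => rfl
      | succ k ih => intro hk; rw [hs_succ, hs_succ, ih (by omega), hab k (by omega)]
    exact this _ le_rfl
  refine tendsto_nhds_unique (tendsto_pi_nhds.1 (hconv a).2 m)
    ((tendsto_pi_nhds.1 (hconv b).2 m).congr' ?_)
  filter_upwards [eventually_ge_atTop n] with j hj
  have hb : y b j ∈ C n (i n ⟨_, hsS a (n + 1)⟩) := by
    have := hyC b hj
    simp only [← hsab] at this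
    exact this
  exact hCf n _ _ hb _ (hyC a hj) m hm

/-- A Borel map on a Borel `E₀`-large set is injective or constant on some canonical
`E₀`-large subset. -/
theorem e0large_inj_or_const (X : Set Cantor) (hX : MeasurableSet X) (hXl : E0Large X)
    (f : X → Cantor) (hf : Measurable f) :
    ∃ U : E0Array, Du U ⊆ X ∧
      ((∀ x y : X, ↑x ∈ Du U → ↑y ∈ Du U → f x = f y → x = y) ∨
        (∃ c, ∀ x : X, ↑x ∈ Du U → f x = c)) := by
  classical
  let f' : Cantor → Cantor := fun x => if h : x ∈ X then f ⟨x, h⟩ else fun _ => false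
  have hf' : Measurable f' := Measurable.dite hf measurable_const hX
  have hff (x : X) : f' x = f x := dif_pos x.2
  obtain ⟨l, φ, hφ, hφX, hg⟩ :=
    exists_isBlockMap_subset hX (fun h => hXl h.relSmoothOn) hf'
  by_cases hne : ∀ n p, ∃ x y, Agree n x p ∧ Agree n y p ∧ f' (φ x) ≠ f' (φ y)
  · obtain ⟨k, ψ, hψ, hinj⟩ := exists_isBlockMap_injective hg hne
    obtain ⟨U, hU⟩ := (hφ.comp hψ).exists_array
    have hDu : Du U = Set.range (φ ∘ ψ) := by rw [Du, hU]
    refine ⟨U, ?_, Or.inl ?_⟩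
    · rw [hDu]; rintro _ ⟨a, rfl⟩; exact hφX _
    · rw [hDu]
      rintro ⟨_, hx⟩ ⟨_, hy⟩ ⟨a, rfl⟩ ⟨b, rfl⟩ hxy
      have : a = b := hinj (by simpa [← hff] using hxy)
      subst this; rfl
  · push Not at hne
    obtain ⟨n, p, hp⟩ := hne
    obtain ⟨k, ψ, hψ, hag⟩ := isBlockMap_append n p
    obtain ⟨U, hU⟩ := (hφ.comp hψ).exists_array
    have hDu : Du U = Set.range (φ ∘ ψ) := by rw [Du, hU]
    refine ⟨U, ?_, Or.inr ⟨f' (φ p), ?_⟩⟩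
    · rw [hDu]; rintro _ ⟨a, rfl⟩; exact hφX _
    · rw [hDu]
      rintro ⟨_, hx⟩ ⟨a, rfl⟩
      rw [← hff]
      exact hp _ _ (hag a) (fun _ _ => rfl)
end

section
/- For every E₀-array u, the canonical E₀-large set D_u = {x_u^a : a ∈ 2^ω} is a perfect subset of 2^ω and is E₀-large (the restriction of E₀ to D_u is not smooth). -/
open MeasureTheory

open Filter Topology Set ProbabilityTheory
open scoped ENNReal

namespace E0Array

variable (U : E0Array)

/-- The concatenation of the first `n` blocks of `xua U a`. -/
def initial (a : Cantor) (n : ℕ) : List Bool :=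
  ((List.range n).map (fun k => U.u k (a k))).flatten

/-- The common length of the concatenations of the first `n` blocks. -/
def start (n : ℕ) : ℕ := ∑ k ∈ Finset.range n, (U.u k false).length

lemma length_block (n : ℕ) (i : Bool) : (U.u n i).length = (U.u n false).length := by
  cases i
  · rfl
  · exact (U.len_eq n).symm

lemma initial_succ (a : Cantor) (n : ℕ) :
    U.initial a (n + 1) = U.initial a n ++ U.u n (a n) := by
  simp [initial, List.range_succ]

lemma length_initial (a : Cantor) (n : ℕ) : (U.initial a n).length = U.start n := by
  induction n with
  | zero => simp [initial, start]
  | succ n ih =>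
    rw [initial_succ, List.length_append, ih, length_block, start, start, Finset.sum_range_succ]

lemma le_start (n : ℕ) : n ≤ U.start n := by
  induction n with
  | zero => simp
  | succ n ih =>
    have := U.len_pos n
    rw [start, Finset.sum_range_succ, ← start]
    omega

lemma initial_congr {a b : Cantor} {n : ℕ} (h : ∀ k < n, a k = b k) :
    U.initial a n = U.initial b n := by
  unfold initial
  congr 1
  refine List.map_congr_left fun k hk => ?_
  rw [h k (List.mem_range.1 hk)]

lemma exists_common_suffix {a b : Cantor} {N : ℕ} (h : ∀ k, N ≤ k → a k = b k) {n : ℕ}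
    (hn : N ≤ n) :
    ∃ r, U.initial a n = U.initial a N ++ r ∧ U.initial b n = U.initial b N ++ r := by
  induction n, hn using Nat.le_induction with
  | base => exact ⟨[], by simp⟩
  | succ n hn ih =>
    obtain ⟨r, ha, hb⟩ := ih
    exact ⟨r ++ U.u n (a n), by simp [initial_succ, ha], by simp [initial_succ, hb, h n hn]⟩

lemma xua_eq_getD (a : Cantor) {m n : ℕ} (h : m < U.start n) :
    xua U a m = (U.initial a n).getD m false := by
  have key : ∀ {p q : ℕ}, m < U.start p → p ≤ q →
      (U.initial a q).getD m false = (U.initial a p).getD m false := by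
    intro p q hp hpq
    obtain ⟨r, hr, -⟩ := U.exists_common_suffix (fun _ _ => rfl : ∀ k, p ≤ k → a k = a k) hpq
    rw [hr, List.getD_append _ _ _ _ (by rwa [length_initial])]
  have h' : m < U.start (m + 1) := U.le_start (m + 1)
  change (U.initial a (m + 1)).getD m false = _
  rcases le_total (m + 1) n with hn | hn
  · exact (key h' hn).symm
  · exact key h hn

lemma exists_xua_ne {a b : Cantor} {n : ℕ} (h : a n ≠ b n) :
    ∃ m, n ≤ m ∧ xua U a m ≠ xua U b m := by
  by_contra! hc
  have key : U.u n (a n) = U.u n (b n) := by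
    refine List.ext_getElem ((U.length_block n _).trans (U.length_block n _).symm) fun j ha hb => ?_
    have hj : U.start n + j < U.start (n + 1) := by
      rw [length_block] at ha
      rw [start, start, Finset.sum_range_succ]
      omega
    have := hc (U.start n + j) (by have := U.le_start n; omega)
    rw [xua_eq_getD U a hj, xua_eq_getD U b hj, initial_succ, initial_succ,
      List.getD_append_right _ _ _ _ (by rw [length_initial]; omega),
      List.getD_append_right _ _ _ _ (by rw [length_initial]; omega),
      length_initial, length_initial, Nat.add_sub_cancel_left,
      List.getD_eq_getElem _ _ ha, List.getD_eq_getElem _ _ hb] at this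
    exact this
  have hne := U.ne n
  revert h key
  cases a n <;> cases b n <;> simp [hne, hne.symm]

lemma xua_injective : Function.Injective (xua U) := by
  intro a b h
  by_contra hab
  obtain ⟨n, hn⟩ := Function.ne_iff.1 hab
  obtain ⟨m, -, hm⟩ := U.exists_xua_ne hn
  exact hm (congrFun h m)

lemma continuous_xua : Continuous (xua U) := by
  refine continuous_pi fun m => IsLocallyConstant.continuous ?_
  refine (IsLocallyConstant.iff_eventually_eq _).2 fun a => ?_
  have : ∀ᶠ b : Cantor in 𝓝 a, ∀ k ∈ Finset.range (m + 1), b k = a k := by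
    refine (Filter.eventually_all_finset _).2 fun k _ => ?_
    exact (continuous_apply k).continuousAt.eventually
      ((isOpen_discrete {a k}).mem_nhds (mem_singleton (a k)))
  filter_upwards [this] with b hb
  change (U.initial b (m + 1)).getD m false = (U.initial a (m + 1)).getD m false
  rw [U.initial_congr fun k hk => hb k (Finset.mem_range.2 hk)]

lemma eZero_xua_iff {a b : Cantor} : eZero (xua U a) (xua U b) ↔ eZero a b := by
  constructor
  · intro h
    obtain ⟨B, hB⟩ := h.bddAbove
    refine (Set.finite_Iic B).subset fun n hn => ?_
    obtain ⟨m, hnm, hm⟩ := U.exists_xua_ne hn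
    exact hnm.trans (hB hm)
  · intro h
    obtain ⟨B, hB⟩ := h.bddAbove
    have hab : ∀ k, B + 1 ≤ k → a k = b k := by
      intro k hk
      by_contra hne
      have : k ≤ B := hB hne
      omega
    refine (Set.finite_Iio (U.start (B + 1))).subset fun m hm => ?_
    by_contra hlt
    rw [Set.mem_Iio, not_lt] at hlt
    have hm' : m < U.start (max (B + 1) (m + 1)) :=
      (le_max_right _ _).trans (U.le_start _)
    obtain ⟨r, ha, hb⟩ := U.exists_common_suffix hab (le_max_left (B + 1) (m + 1))
    apply hm
    rw [xua_eq_getD U a hm', xua_eq_getD U b hm', ha, hb,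
      List.getD_append_right _ _ _ _ (by rwa [length_initial]),
      List.getD_append_right _ _ _ _ (by rwa [length_initial]), length_initial, length_initial]

lemma perfectSet_Du : PerfectSet (Du U) := by
  refine ⟨⟨(isCompact_range U.continuous_xua).isClosed, ?_⟩, range_nonempty _⟩
  rw [preperfect_iff_nhds]
  rintro _ ⟨a, rfl⟩ V hV
  have hlim : Tendsto (fun n => Function.update a n (!a n)) atTop (𝓝 a) := by
    refine tendsto_pi_nhds.2 fun k => tendsto_const_nhds.congr' ?_
    filter_upwards [eventually_gt_atTop k] with n hn
    rw [Function.update_of_ne hn.ne]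
  obtain ⟨n, hn⟩ := ((U.continuous_xua.tendsto a).comp hlim |>.eventually hV).exists
  refine ⟨_, ⟨hn, mem_range_self _⟩, fun h => ?_⟩
  have := congrFun (U.xua_injective h) n
  simp at this

end E0Array

/-- The fair coin measure on `Bool`. -/
noncomputable def fairCoin : Measure Bool :=
  (2 : ℝ≥0∞)⁻¹ • (Measure.dirac false + Measure.dirac true)

instance : IsProbabilityMeasure fairCoin :=
  ⟨by simp [fairCoin, ENNReal.inv_two_add_inv_two]⟩

lemma fairCoin_map_not : fairCoin.map (fun b => !b) = fairCoin := by
  have h : Measurable (fun b : Bool => !b) := measurable_from_top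
  rw [fairCoin, Measure.map_smul, Measure.map_add _ _ h, Measure.map_dirac' h,
    Measure.map_dirac' h, add_comm]
  rfl

/-- The coin-tossing measure on Cantor space. -/
noncomputable def coinTossing : Measure Cantor := Measure.infinitePi fun _ => fairCoin

instance : IsProbabilityMeasure coinTossing :=
  inferInstanceAs (IsProbabilityMeasure (Measure.infinitePi fun _ => fairCoin))

lemma measurePreserving_not :
    MeasurePreserving (fun (a : Cantor) n => !a n) coinTossing coinTossing := by
  have h : ∀ _ : ℕ, Measurable (fun b : Bool => !b) := fun _ => measurable_from_top
  refine ⟨measurable_pi_lambda _ fun n => (h n).comp (measurable_pi_apply n), ?_⟩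
  rw [coinTossing, Measure.infinitePi_map_pi _ h]
  simp only [fairCoin_map_not]

lemma coinTossing_eq_zero_or_one {t : Set Cantor} (ht : MeasurableSet t)
    (hinv : ∀ a b, eZero a b → a ∈ t → b ∈ t) : coinTossing t = 0 ∨ coinTossing t = 1 := by
  let s : ℕ → MeasurableSpace Cantor := fun n => MeasurableSpace.comap (fun a => a n) inferInstance
  have hle : ∀ n, s n ≤ MeasurableSpace.pi := fun n => (measurable_pi_apply n).comap_le
  have hind : iIndep s coinTossing :=
    iIndepFun_infinitePi (P := fun _ : ℕ => fairCoin) (X := fun _ b => b) fun _ => measurable_id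
  refine measure_zero_or_one_of_measurableSet_limsup_atTop hle hind ?_
  rw [limsup_eq_iInf_iSup_of_nat, MeasurableSpace.measurableSet_iInf]
  intro N
  let φ : Cantor → Cantor := fun a n => if N ≤ n then a n else false
  have hφ : @Measurable _ _ (⨆ n ≥ N, s n) _ φ := by
    refine @measurable_pi_lambda _ _ _ (⨆ n ≥ N, s n) _ φ fun n => ?_
    by_cases hn : N ≤ n
    · simp only [φ, if_pos hn]
      exact Measurable.mono (comap_measurable _) (le_iSup₂_of_le n hn le_rfl) le_rfl
    · simp only [φ, if_neg hn]
      exact measurable_const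
  have hfin : ∀ a, {k | φ a k ≠ a k}.Finite := fun a =>
    (Set.finite_Iio N).subset fun k hk => by
      by_contra hlt
      exact hk (if_pos (not_lt.1 hlt))
  have hpre : φ ⁻¹' t = t := by
    ext a
    refine ⟨hinv _ _ (hfin a), hinv _ _ ?_⟩
    simpa only [eZero, ne_comm] using hfin a
  rw [← hpre]
  exact hφ ht

lemma not_exists_measurable_reduction_eZero :
    ¬ ∃ g : Cantor → Cantor, Measurable g ∧ ∀ a b, eZero a b ↔ g a = g b := by
  rintro ⟨g, hg, hgE⟩
  have hbit : ∀ n, ∃ c : Bool, ∀ᵐ a ∂coinTossing, g a n = c := by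
    intro n
    have hmeas : MeasurableSet {a | g a n = true} :=
      (measurable_pi_apply n).comp hg (measurableSet_singleton true)
    rcases coinTossing_eq_zero_or_one hmeas
      (fun a b hab ha => by rwa [mem_ofPred_eq, ← (hgE a b).1 hab]) with h | h
    · refine ⟨false, ?_⟩
      filter_upwards [measure_eq_zero_iff_ae_notMem.1 h] with a ha
      simpa using ha
    · exact ⟨true, (prob_compl_eq_zero_iff hmeas).2 h⟩
  choose c hc using hbit
  have hconst : ∀ᵐ a ∂coinTossing, g a = c := by
    filter_upwards [ae_all_iff.2 hc] with a ha using funext ha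
  obtain ⟨a, ha, hna⟩ :=
    (hconst.and (measurePreserving_not.quasiMeasurePreserving.ae hconst)).exists
  have hfin : {k | a k ≠ !a k}.Finite := (hgE _ _).2 (ha.trans hna.symm)
  exact Set.infinite_univ (by simpa using hfin : (univ : Set ℕ).Finite)

/-- Each canonical `E₀`-large set `D_u` is a perfect subset of Cantor space and is
`E₀`-large. -/
theorem du_perfect_and_e0large (U : E0Array) :
    PerfectSet (Du U) ∧ E0Large (Du U) := by
  refine ⟨U.perfectSet_Du, ?_⟩
  rintro ⟨f, hf, hfE⟩
  refine not_exists_measurable_reduction_eZero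
    ⟨fun a => f ⟨xua U a, mem_range_self a⟩, hf.comp ?_, fun a b => ?_⟩
  · exact U.continuous_xua.measurable.subtype_mk
  · rw [← hfE, U.eZero_xua_iff]
end

section
/- Assume that ⟨D,E⟩ is a double-bubble system, X ⊆ 2^ω is a perfect set, and f : X → 2^ω is a Borel injective map. Then there exist a perfect set Y ⊆ X and a double-bubble system ⟨D',E'⟩ which extends ⟨D,E⟩ and accommodates f↾Y, i.e., f(x) E' x for all x ∈ Y. -/
open MeasureTheory

open Filter Topology Set in
/-- **Kuratowski–Ulam**: almost every section of a residual set is residual. -/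
theorem eventually_residual_section {X Y : Type*} [TopologicalSpace X] [TopologicalSpace Y]
    [SecondCountableTopology Y] {T : Set (X × Y)} (hT : T ∈ residual (X × Y)) :
    ∀ᶠ x in residual X, ∀ᶠ y in residual Y, (x, y) ∈ T := by
  obtain ⟨S, hSo, hSd, hSc, hST⟩ := mem_residual_iff.1 hT
  have key : ∀ G ∈ S, ∀ᶠ x in residual X, ∀ᶠ y in residual Y, (x, y) ∈ G := by
    intro G hG
    have hW : ∀ W ∈ TopologicalSpace.countableBasis Y,
        ∀ᶠ x in residual X, ∃ y ∈ W, (x, y) ∈ G := by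
      intro W hW
      have hWo := TopologicalSpace.isOpen_of_mem_countableBasis hW
      have hWn := TopologicalSpace.nonempty_of_mem_countableBasis hW
      have heq : {x | ∃ y ∈ W, (x, y) ∈ G} = Prod.fst '' (G ∩ univ ×ˢ W) := by
        ext x; simp [and_comm]
      refine residual_of_dense_open ?_ (dense_iff_inter_open.2 fun V hV hVn => ?_)
      · rw [heq]
        exact isOpenMap_fst _ ((hSo G hG).inter (isOpen_univ.prod hWo))
      · obtain ⟨⟨x, y⟩, ⟨hx, hy⟩, hxy⟩ :=
          (hSd G hG).inter_open_nonempty (V ×ˢ W) (hV.prod hWo) (hVn.prod hWn)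
        exact ⟨x, hx, y, hy, hxy⟩
    filter_upwards [(eventually_countable_ball (TopologicalSpace.countable_countableBasis Y)).2 hW]
      with x hx
    refine residual_of_dense_open ((hSo G hG).preimage (Continuous.prodMk_right x)) ?_
    refine (TopologicalSpace.isBasis_countableBasis Y).dense_iff.2 fun W hW _ => ?_
    obtain ⟨y, hy, hxy⟩ := hx W hW
    exact ⟨y, hy, hxy⟩
  filter_upwards [(eventually_countable_ball hSc).2 key] with x hx
  filter_upwards [(eventually_countable_ball hSc).2 hx] with y hy
  exact hST hy

open Filter Topology Set in
/-- A set with the Baire property all of whose sections are meagre is meagre. -/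
theorem isMeagre_of_forall_section {X Y : Type*} [TopologicalSpace X] [TopologicalSpace Y]
    [SecondCountableTopology Y] [BaireSpace X] [BaireSpace Y] {S : Set (X × Y)}
    (hS : BaireMeasurableSet S) (hsec : ∀ x, IsMeagre {y | (x, y) ∈ S}) : IsMeagre S := by
  obtain ⟨U, hU, hSU⟩ := hS.residualEq_isOpen
  have hUe : U = ∅ := by
    by_contra hne
    obtain ⟨⟨x₀, y₀⟩, h₀⟩ := nonempty_iff_ne_empty.2 hne
    obtain ⟨V, W, hV, hW, hxV, hyW, hVW⟩ := isOpen_prod_iff.1 hU x₀ y₀ h₀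
    obtain ⟨x, hxV, hx⟩ := (dense_of_mem_residual
      (eventually_residual_section hSU.mem_iff)).inter_open_nonempty V hV ⟨x₀, hxV⟩
    obtain ⟨y, hyW, hy, hyS⟩ := (dense_of_mem_residual
      (inter_mem hx (hsec x))).inter_open_nonempty W hW ⟨y₀, hyW⟩
    exact hyS (hy.2 (hVW ⟨hxV, hyW⟩))
  subst hUe
  filter_upwards [hSU.mem_iff] with p hp h
  exact hp.1 h

/-- Countable sets are meagre in a space without isolated points. -/
theorem Set.Countable.isMeagre_of_perfectSpace {X : Type*} [TopologicalSpace X] [T1Space X]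
    [PerfectSpace X] {s : Set X} (hs : s.Countable) : IsMeagre s := by
  rw [← Set.biUnion_of_singleton s]
  refine isMeagre_biUnion hs fun x _ => ?_
  exact residual_of_dense_open isOpen_compl_singleton (dense_compl_singleton x)

instance Pi.perfectSpace_nat_bool : PerfectSpace (ℕ → Bool) := by
  refine perfectSpace_iff_forall_not_isolated.2 fun x => ?_
  have h : Filter.Tendsto (fun n => Function.update x n (!x n)) Filter.atTop
      (nhdsWithin x {x}ᶜ) := by
    refine tendsto_nhdsWithin_iff.2 ⟨tendsto_pi_nhds.2 fun k => ?_, .of_forall fun n h => ?_⟩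
    · refine tendsto_const_nhds.congr' ?_
      filter_upwards [Filter.eventually_gt_atTop k] with n hn
      rw [Function.update_of_ne hn.ne]
    · simpa using congrFun h n
  exact h.neBot

open Filter Topology Set in
/-- In a finite power of `X`, off-diagonal pairs of coordinates generically lie in a given
dense open subset of `X × X`. -/
theorem dense_forall_pair_mem {ι X : Type*} [Finite ι] [TopologicalSpace X]
    {G : Set (X × X)} (hGo : IsOpen G) (hGd : Dense G) :
    Dense {z : ι → X | ∀ i j, i ≠ j → (z i, z j) ∈ G} := by
  classical
  have hset : {z : ι → X | ∀ i j, i ≠ j → (z i, z j) ∈ G} =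
      ⋂₀ range fun p : {p : ι × ι // p.1 ≠ p.2} => {z | (z p.1.1, z p.1.2) ∈ G} := by
    ext z; simp
  rw [hset]
  refine (finite_range _).dense_sInter ?_ ?_
  · rintro _ ⟨p, rfl⟩
    exact hGo.preimage (by fun_prop)
  · rintro _ ⟨⟨⟨i, j⟩, hij⟩, rfl⟩
    dsimp only at hij ⊢
    refine dense_iff_inter_open.2 fun V hV ⟨z, hz⟩ => ?_
    have hcont : Continuous fun p : X × X => Function.update (Function.update z i p.1) j p.2 :=
      by fun_prop
    obtain ⟨p, hpV, hpG⟩ := hGd.inter_open_nonempty _ (hV.preimage hcont)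
      ⟨(z i, z j), by simpa using hz⟩
    exact ⟨_, hpV, by simpa [hij] using hpG⟩

/-- The extension of a finite tuple of bits by `false`. -/
def finiteExtend {N : ℕ} (s : Fin N → Bool) : ℕ → Bool :=
  fun k => if h : k < N then s ⟨k, h⟩ else false

open Filter Topology Set in
/-- Continuous maps on the Cantor space are uniformly approximated by locally constant ones. -/
theorem eventually_forall_dist_finiteExtend_lt {Z : Type*} [PseudoMetricSpace Z]
    (h : C(ℕ → Bool, Z)) {ε : ℝ} (hε : 0 < ε) :
    ∀ᶠ N in atTop, ∀ a, dist (h a) (h (finiteExtend fun k : Fin N => a k)) < ε := by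
  have hρ : TendstoUniformly (fun (N : ℕ) (a : ℕ → Bool) => finiteExtend fun k : Fin N => a k)
      id atTop := by
    rw [tendstoUniformly_iff_tendsto, Pi.uniformity, tendsto_iInf]
    refine fun k => tendsto_comap_iff.2 (tendsto_principal.2 ?_ |>.mono_right refl_le_uniformity)
    filter_upwards [tendsto_fst.eventually (eventually_gt_atTop k)] with p hp
    simp [finiteExtend, hp]
  exact Metric.tendstoUniformly_iff.1
    ((CompactSpace.uniformContinuous_of_continuous h.continuous).comp_tendstoUniformly hρ) ε hε

open Filter Topology Set in
/-- **Mycielski's theorem**: a residual binary relation on a Polish space holds between any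
two distinct points of some continuous image of the Cantor space. -/
theorem exists_continuousMap_pairwise_mem_residual {Z : Type*} [TopologicalSpace Z]
    [TopologicalSpace.IsCompletelyMetrizableSpace Z] [Nonempty Z]
    {T : Set (Z × Z)} (hT : T ∈ residual (Z × Z)) :
    ∃ h : C(ℕ → Bool, Z), Pairwise fun a b => (h a, h b) ∈ T := by
  let := TopologicalSpace.upgradeIsCompletelyMetrizable Z
  obtain ⟨S, hSo, hSd, hSc, hST⟩ := mem_residual_iff.1 hT
  have key : ∀ G ∈ S, ∀ n : ℕ,
      ∀ᶠ h : C(ℕ → Bool, Z) in residual _, ∀ a b : ℕ → Bool, a n ≠ b n → (h a, h b) ∈ G := by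
    intro G hG n
    refine residual_of_dense_open ?_ (Metric.dense_iff.2 fun h ε hε => ?_)
    · have hK : IsCompact {p : (ℕ → Bool) × (ℕ → Bool) | p.1 n ≠ p.2 n} := by
        have : IsClopen {p : (ℕ → Bool) × (ℕ → Bool) | p.1 n ≠ p.2 n} :=
          (isClopen_discrete {q : Bool × Bool | q.1 ≠ q.2}).preimage
            (f := fun p : (ℕ → Bool) × (ℕ → Bool) => (p.1 n, p.2 n)) (by fun_prop)
        exact this.isClosed.isCompact
      have ho := (ContinuousMap.isOpen_setOfPred_mapsTo hK (hSo G hG)).preimage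
        
        (ContinuousMap.continuous_of_continuous_uncurry
          (fun h : C(ℕ → Bool, Z) => h.prodMap h) (by
          simp only [Function.uncurry_def, ContinuousMap.prodMap_apply, Prod.map]; fun_prop))
      convert ho using 1
      ext h
      simp [MapsTo]
    · obtain ⟨N, hN, hnN⟩ :=
        ((eventually_forall_dist_finiteExtend_lt h (half_pos (half_pos hε))).and
          (eventually_gt_atTop n)).exists
      obtain ⟨z, hz, hzG⟩ := (dense_forall_pair_mem (ι := Fin N → Bool)
        (hSo G hG) (hSd G hG)).inter_open_nonempty
        (Metric.ball (fun s => h (finiteExtend s)) (ε / 4)) Metric.isOpen_ball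
        (Metric.nonempty_ball.2 (by positivity))
      refine ⟨⟨fun a => z fun k => a k, ?_⟩, ?_, fun a b hab => ?_⟩
      · exact continuous_of_discreteTopology.comp
          (continuous_pi fun k : Fin N => continuous_apply (k : ℕ))
      · rw [Metric.mem_ball, dist_comm, ContinuousMap.dist_lt_iff hε]
        intro a
        have h1 := hN a
        have h2 := (dist_pi_lt_iff (by positivity)).1 (Metric.mem_ball.1 hz) fun k : Fin N => a k
        rw [dist_comm] at h2
        have h3 := dist_triangle (h a) (h (finiteExtend fun k : Fin N => a k))
          (z fun k : Fin N => a k)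
        simp only [ContinuousMap.coe_mk]
        linarith
      · exact hzG _ _ fun he => hab (congrFun he ⟨n, hnN⟩)
  have hall : ∀ᶠ h : C(ℕ → Bool, Z) in residual _, ∀ G ∈ S, ∀ n : ℕ,
      ∀ a b : ℕ → Bool, a n ≠ b n → (h a, h b) ∈ G :=
    (eventually_countable_ball hSc).2 fun G hG => eventually_countable_forall.2 (key G hG)
  have : Nonempty C(ℕ → Bool, Z) := ⟨.const _ (Classical.arbitrary Z)⟩
  obtain ⟨h, hh⟩ := (dense_of_mem_residual hall).nonempty
  refine ⟨h, fun a b hab => hST fun G hG => ?_⟩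
  obtain ⟨n, hn⟩ := Function.ne_iff.1 hab
  exact hh G hG n a b hn

theorem DBS.d_iff {D E : Cantor → Cantor → Prop} (h : DBS D E) {x y z : Cantor}
    (hxy : E x y) (hyz : E y z) : D x z ↔ (D x y ↔ D y z) := by
  obtain ⟨w, -, -, hw⟩ := h.double y
  have sy {a b} : D a b → D b a := h.equivD.symm
  have tr {a b c} : D a b → D b c → D a c := h.equivD.trans
  have h1 := hw x (h.equivE.symm hxy)
  have h2 := hw z hyz
  grind

/-- Pulling a double-bubble system back along a Borel countable-to-one map `r`, with the two halves
of each class exchanged according to `t`, extends it as soon as `r` and `t` are compatible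
with it. -/
theorem DBS.pullback {D E : Cantor → Cantor → Prop} (h : DBS D E) {r : Cantor → Cantor}
    {t : Cantor → Prop} (hr : Measurable r) (ht : MeasurableSet {a | t a})
    (hfib : ∀ c, (r ⁻¹' {c}).Countable) (hE : ∀ x y, E x y → E (r x) (r y))
    (hD : ∀ x y, E x y → ((D (r x) (r y) ↔ (t x ↔ t y)) ↔ D x y)) :
    DBS (fun x y => E (r x) (r y) ∧ (D (r x) (r y) ↔ (t x ↔ t y))) (fun x y => E (r x) (r y)) ∧
      DBSle D E (fun x y => E (r x) (r y) ∧ (D (r x) (r y) ↔ (t x ↔ t y)))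
        (fun x y => E (r x) (r y)) := by
  have hE' : MeasurableSet {p : Cantor × Cantor | E (r p.1) (r p.2)} :=
    h.borelE.preimage (hr.prodMap hr)
  have hD' : MeasurableSet {p : Cantor × Cantor | D (r p.1) (r p.2)} :=
    h.borelD.preimage (hr.prodMap hr)
  have ht₁ : MeasurableSet {p : Cantor × Cantor | t p.1} := ht.preimage measurable_fst
  have ht₂ : MeasurableSet {p : Cantor × Cantor | t p.2} := ht.preimage measurable_snd
  have hc : ∀ x, {y | E (r x) (r y)}.Countable := fun x =>
    ((h.countableE (r x)).biUnion fun c _ => hfib c).mono fun y hy => by simpa using hy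
  refine ⟨⟨⟨fun x => ⟨h.equivE.refl _, by simp [h.equivD.refl]⟩, fun {x y} hxy => ?_,
    fun {x y z} hxy hyz => ?_⟩, ⟨fun x => h.equivE.refl _, h.equivE.symm, h.equivE.trans⟩,
    ?_, hE', fun x => (hc x).mono fun y hy => hy.1, hc, fun x y hxy => hxy.1, fun x => ?_⟩,
    fun x y hxy => ⟨hE _ _ (h.sub _ _ hxy), (hD _ _ (h.sub _ _ hxy)).2 hxy⟩, hE,
    fun x y hxy hn hxy' => hn ((hD _ _ hxy).1 hxy'.2)⟩
  · refine ⟨h.equivE.symm hxy.1, ?_⟩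
    rw [show D (r y) (r x) ↔ D (r x) (r y) from ⟨h.equivD.symm, h.equivD.symm⟩, hxy.2]
    exact Iff.comm
  · refine ⟨h.equivE.trans hxy.1 hyz.1, ?_⟩
    rw [h.d_iff hxy.1 hyz.1, hxy.2, hyz.2]
    tauto
  · exact hE'.inter (hD'.iff (ht₁.iff ht₂))
  · obtain ⟨y, hxy, hnxy, -⟩ := h.double x
    refine ⟨y, hE _ _ hxy, fun hc => hnxy ((hD _ _ hxy).1 hc.2), fun z hxz => ?_⟩
    have hyx := h.equivE.symm (hE _ _ hxy)
    have h1 := h.d_iff hyx hxz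
    have h2 := mt (hD _ _ hxy).1 hnxy
    have h3 : D (r y) (r x) ↔ D (r x) (r y) := ⟨h.equivD.symm, h.equivD.symm⟩
    have h4 : E (r y) (r z) := h.equivE.trans hyx hxz
    grind

open Classical in
/-- If `u` picks pairwise `E`-inequivalent points and `v` is an injection avoiding
their classes, then some extension of a double-bubble system identifies each `u p` with `v p`. -/
theorem DBS.exists_extension {P : Type*} [MeasurableSpace P] [StandardBorelSpace P]
    {D E : Cantor → Cantor → Prop} (h : DBS D E) {u v : P → Cantor}
    (hu : Measurable u) (hv : Measurable v) (hvi : Function.Injective v)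
    (huu : ∀ p q, E (u p) (u q) → p = q) (huv : ∀ p q, ¬ E (u p) (v q)) :
    ∃ D' E', DBS D' E' ∧ DBSle D E D' E' ∧ ∀ p, E' (v p) (u p) := by
  have sy {a b} : E a b → E b a := h.equivE.symm
  have tr {a b c} : E a b → E b c → E a c := h.equivE.trans
  have hu_unique : ∀ {a p q}, E (u p) a → E (u q) a → p = q := fun hp hq => huu _ _ (tr hp (sy hq))
  have hproj : ∀ {S : Set (Cantor × P)}, MeasurableSet S → (∀ s ∈ S, E (u s.2) s.1) →
      MeasurableSet (Prod.fst '' S) := by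
    intro S hS hSE
    refine hS.image_of_measurable_injOn measurable_fst ?_
    rintro ⟨a, p⟩ hp ⟨b, q⟩ hq hab
    obtain rfl : a = b := hab
    exact congrArg (a, ·) (hu_unique (hSE (a, p) hp) (hSE (a, q) hq))
  have hmE : MeasurableSet {s : Cantor × P | E (u s.2) s.1} :=
    h.borelE.preimage ((hu.comp measurable_snd).prodMk measurable_fst)
  have hmD : MeasurableSet {s : Cantor × P | D (u s.2) s.1} :=
    h.borelD.preimage ((hu.comp measurable_snd).prodMk measurable_fst)
  let r : Cantor → Cantor := fun a => if ha : ∃ p, E (u p) a then v ha.choose else a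
  let t : Cantor → Prop := fun a => ∃ p, E (u p) a ∧ ¬ D (u p) a
  have hr_in : ∀ {a p}, E (u p) a → r a = v p := fun {a p} hp => by
    have ha : ∃ p, E (u p) a := ⟨p, hp⟩
    simp only [r, dif_pos ha]
    rw [hu_unique ha.choose_spec hp]
  have hr_out : ∀ {a}, (¬ ∃ p, E (u p) a) → r a = a := fun ha => dif_neg ha
  have ht_in : ∀ {a p}, E (u p) a → (t a ↔ ¬ D (u p) a) := fun {a p} hp =>
    ⟨fun ⟨q, hq, hqD⟩ => hu_unique hp hq ▸ hqD, fun hD => ⟨p, hp, hD⟩⟩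
  have hr : Measurable r := by
    intro B hB
    have hset : r ⁻¹' B = Prod.fst '' ({s : Cantor × P | E (u s.2) s.1} ∩ {s | v s.2 ∈ B}) ∪
        ((Prod.fst '' {s : Cantor × P | E (u s.2) s.1})ᶜ ∩ B) := by
      ext a
      by_cases ha : ∃ p, E (u p) a
      · obtain ⟨p, hp⟩ := ha
        have : ∀ q, E (u q) a ∧ v q ∈ B ↔ q = p ∧ v p ∈ B := fun q =>
          ⟨fun hq => by obtain rfl := hu_unique hq.1 hp; exact ⟨rfl, hq.2⟩,
            fun hq => by rw [hq.1]; exact ⟨hp, hq.2⟩⟩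
        simp only [Set.mem_preimage, hr_in hp, Set.mem_union, Set.mem_image, Set.mem_inter_iff,
          Set.mem_ofPred_eq, Prod.exists, exists_and_right, exists_eq_right, this,
          Set.mem_compl_iff]
        grind
      · simp only [Set.mem_preimage, hr_out ha]
        simp only [not_exists] at ha
        simp [ha]
    rw [hset]
    exact (hproj (hmE.inter (hB.preimage (hv.comp measurable_snd))) fun s hs => hs.1).union
      ((hproj hmE fun s hs => hs).compl.inter hB)
  have ht : MeasurableSet {a | t a} := by
    convert hproj (hmE.diff hmD) (fun s hs => hs.1) using 1
    ext a
    simp [t]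
  have hfib : ∀ c, (r ⁻¹' {c}).Countable := by
    intro c
    by_cases hc : ∃ p, v p = c
    · obtain ⟨p, rfl⟩ := hc
      refine ((h.countableE (u p)).insert (v p)).mono fun a ha => ?_
      by_cases hq : ∃ q, E (u q) a
      · obtain ⟨q, hq⟩ := hq
        obtain rfl : q = p := hvi ((hr_in hq).symm.trans ha)
        exact .inr hq
      · exact .inl ((hr_out hq).symm.trans ha)
    · refine (Set.countable_singleton c).mono fun a ha => ?_
      by_cases hq : ∃ q, E (u q) a
      · obtain ⟨q, hq⟩ := hq
        exact (hc ⟨q, (hr_in hq).symm.trans ha⟩).elim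
      · exact (hr_out hq).symm.trans ha
  have hrE : ∀ x y, E x y → E (r x) (r y) ∧
      ((D (r x) (r y) ↔ (t x ↔ t y)) ↔ D x y) := by
    intro x y hxy
    by_cases hx : ∃ p, E (u p) x
    · obtain ⟨p, hp⟩ := hx
      have hp' := tr hp hxy
      have h1 := h.d_iff (sy hp) hp'
      have h2 : D x (u p) ↔ D (u p) x := ⟨h.equivD.symm, h.equivD.symm⟩
      rw [hr_in hp, hr_in hp', ht_in hp, ht_in hp', h1, h2]
      exact ⟨h.equivE.refl _, by simp [h.equivD.refl, not_iff_not]⟩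
    · have hy : ¬ ∃ p, E (u p) y := fun ⟨p, hp⟩ => hx ⟨p, tr hp (sy hxy)⟩
      have htx : ¬ t x := fun ⟨p, hp, _⟩ => hx ⟨p, hp⟩
      have hty : ¬ t y := fun ⟨p, hp, _⟩ => hy ⟨p, hp⟩
      rw [hr_out hx, hr_out hy]
      exact ⟨hxy, by simp [htx, hty]⟩
  obtain ⟨h1, h2⟩ := h.pullback hr ht hfib (fun x y hxy => (hrE x y hxy).1)
    (fun x y hxy => (hrE x y hxy).2)
  refine ⟨_, _, h1, h2, fun p => ?_⟩
  rw [hr_in (h.equivE.refl (u p)), hr_out fun ⟨q, hq⟩ => huv q p hq]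
  exact h.equivE.refl _

/-- An uncountable Borel subset of a Polish space contains a continuous injective image of the
Cantor space. -/
theorem MeasurableSet.exists_nat_bool_injection_of_not_countable {Z : Type*} [TopologicalSpace Z]
    [PolishSpace Z] [MeasurableSpace Z] [BorelSpace Z] {B : Set Z} (hB : MeasurableSet B)
    (hunc : ¬ B.Countable) :
    ∃ g : (ℕ → Bool) → Z, Set.range g ⊆ B ∧ Continuous g ∧ Function.Injective g := by
  obtain ⟨t', ht', hP, hcl, -⟩ := hB.isClopenable
  obtain ⟨g, hg, hgc, hgi⟩ :=
    @IsClosed.exists_nat_bool_injection_of_not_countable Z t' hP B hcl hunc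
  exact ⟨g, hg, continuous_le_rng ht' hgc, hgi⟩

instance Pi.polishSpace_nat_bool : PolishSpace (ℕ → Bool) where

theorem Function.Injective.not_countable_range_nat_bool {Z : Type*} {g : (ℕ → Bool) → Z}
    (hg : Function.Injective g) : ¬ (Set.range g).Countable := fun h => by
  have : Countable (ℕ → Bool) := Set.countable_univ_iff.1
    (Set.preimage_range g ▸ h.preimage hg)
  rw [← Cardinal.mk_le_aleph0_iff] at this
  exact this.not_gt (by simp [Cardinal.aleph0_lt_continuum])

/-- The range of a continuous injection on the Cantor space contains a perfect set. -/
theorem exists_perfectSet_subset_range {g : Cantor → Cantor} (hg : Continuous g)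
    (hgi : Function.Injective g) : ∃ Y ⊆ Set.range g, PerfectSet Y := by
  obtain ⟨Y, hY, hYn, hYg⟩ := exists_perfect_nonempty_of_isClosed_of_not_countable
    (isCompact_range hg).isClosed hgi.not_countable_range_nat_bool
  exact ⟨Y, hYg, hY, hYn⟩

theorem PerfectSet.not_countable {X : Set Cantor} (hX : PerfectSet X) : ¬ X.Countable := by
  let := TopologicalSpace.upgradeIsCompletelyMetrizable Cantor
  obtain ⟨g, hg, -, hgi⟩ := Perfect.exists_nat_bool_injection hX.1 hX.2
  exact fun h => hgi.not_countable_range_nat_bool (h.mono hg)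

/-- Accommodation lemma, Sacks case: given a double-bubble system `⟨D,E⟩`, a perfect
set `X`, and a Borel injection `f : X → 2^ω`, there are a perfect `Y ⊆ X` and a DBS
`⟨D',E'⟩` extending `⟨D,E⟩` which accommodates `f↾Y`. -/
theorem accommodate_sacks (D E : Cantor → Cantor → Prop) (hDE : DBS D E)
    (X : Set Cantor) (hX : PerfectSet X)
    (f : X → Cantor) (hf : Measurable f) (hfi : Function.Injective f) :
    ∃ Y, Y ⊆ X ∧ PerfectSet Y ∧
      ∃ D' E', DBS D' E' ∧ DBSle D E D' E' ∧
        ∀ x : X, ↑x ∈ Y → E' (f x) ↑x := by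
  have hXm : MeasurableSet X := hX.1.closed.measurableSet
  have hXE : MeasurableSet {x : X | E (f x) x} :=
    hDE.borelE.preimage (hf.prodMk measurable_subtype_coe)
  have hunc := hX.not_countable
  by_cases hA : ((↑) '' {x : X | E (f x) x} : Set Cantor).Countable
  · have hB : ¬ ((↑) '' {x : X | ¬ E (f x) x} : Set Cantor).Countable := fun hB => hunc <|
      (hA.union hB).mono fun x hx => by
        by_cases h : E (f ⟨x, hx⟩) x
        · exact .inl ⟨_, h, rfl⟩
        · exact .inr ⟨_, h, rfl⟩
    obtain ⟨g, hgB, hg, hgi⟩ :=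
      (hXm.subtype_image hXE.compl).exists_nat_bool_injection_of_not_countable hB
    have hgX : ∀ p, ∃ hp : g p ∈ X, ¬ E (f ⟨g p, hp⟩) (g p) := fun p => by
      obtain ⟨x, hx, hxp⟩ := hgB ⟨p, rfl⟩
      exact ⟨hxp ▸ x.2, by simpa [← hxp] using hx⟩
    choose hgX hgE using hgX
    let v : Cantor → Cantor := fun p => f ⟨g p, hgX p⟩
    have hv : Measurable v := hf.comp (hg.measurable.subtype_mk)
    have hvi : Function.Injective v := fun p q hpq => hgi (Subtype.mk.inj (hfi hpq))
    have hm : ∀ w : Cantor → Cantor, Measurable w → Function.Injective w →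
        IsMeagre {p : Cantor × Cantor | E (g p.1) (w p.2)} := fun w hw hwi =>
      isMeagre_of_forall_section
        (hDE.borelE.preimage ((hg.measurable.comp measurable_fst).prodMk
          (hw.comp measurable_snd))).baireMeasurableSet
        fun x => ((hDE.countableE (g x)).preimage hwi).isMeagre_of_perfectSpace
    obtain ⟨h, hh⟩ := exists_continuousMap_pairwise_mem_residual
      (Filter.inter_mem (hm g hg.measurable hgi) (hm v hv hvi))
    have hhg : ∀ p q, E (g (h p)) (g (h q)) → p = q := fun p q hpq => by
      by_contra hne
      exact (hh hne).1 hpq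
    have hhi : Function.Injective h := fun p q hpq => hhg p q (hpq ▸ hDE.equivE.refl _)
    obtain ⟨D', E', hDE', hle, hacc⟩ := hDE.exists_extension (u := g ∘ h) (v := v ∘ h)
      (hg.comp h.continuous).measurable (hv.comp h.continuous.measurable) (hvi.comp hhi) hhg
      (fun p q hpq => by
        by_cases hne : p = q
        · subst hne
          exact hgE _ (hDE.equivE.symm hpq)
        · exact (hh hne).2 hpq)
    obtain ⟨Y, hYr, hY⟩ := exists_perfectSet_subset_range (hg.comp h.continuous) (hgi.comp hhi)
    refine ⟨Y, ?_, hY, D', E', hDE', hle, ?_⟩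
    · intro y hy
      obtain ⟨p, rfl⟩ := hYr hy
      exact hgX _
    · rintro ⟨x, hx⟩ hxY
      obtain ⟨p, rfl⟩ := hYr hxY
      exact hacc p
  · obtain ⟨g, hgA, hg, hgi⟩ :=
      (hXm.subtype_image hXE).exists_nat_bool_injection_of_not_countable hA
    obtain ⟨Y, hYg, hY⟩ := exists_perfectSet_subset_range hg hgi
    refine ⟨Y, ?_, hY, D, E, hDE, ⟨fun _ _ => id, fun _ _ => id, fun _ _ _ => id⟩, ?_⟩
    · intro y hy
      obtain ⟨x, -, rfl⟩ := hgA (hYg hy)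
      exact x.2
    · intro x hx
      obtain ⟨x', hx', he⟩ := hgA (hYg hx)
      rwa [Subtype.ext he] at hx'
end

section
/- Let ⟨D,E⟩ be a double-bubble system and let R, X ⊆ 2^ω be perfect sets. Then there exist: a perfect set Y ⊆ X, Borel injective maps f, g : Y → R, and a double-bubble system ⟨D',E'⟩ which extends ⟨D,E⟩, positively accommodates f (f(x) D' x for all x ∈ Y), and negatively accommodates g (g(x) E' x but not g(x) D' x, for all x ∈ Y). -/
open MeasureTheory

open Topology Filter Set

theorem eventually_residual_of_mem_residual_prod {α β : Type*} [TopologicalSpace α]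
    [TopologicalSpace β] [SecondCountableTopology β] {s : Set (α × β)}
    (hs : s ∈ residual (α × β)) : ∀ᶠ x in residual α, ∀ᶠ y in residual β, (x, y) ∈ s := by
  obtain ⟨S, hSo, hSd, hSc, hSs⟩ := mem_residual_iff.1 hs
  have key : ∀ t ∈ S, ∀ᶠ x in residual α, ∀ᶠ y in residual β, (x, y) ∈ t := by
    intro t ht
    have hB : ∀ b ∈ TopologicalSpace.countableBasis β,
        ∀ᶠ x in residual α, ∃ y ∈ b, (x, y) ∈ t := by
      intro b hb
      have hbo := TopologicalSpace.isOpen_of_mem_countableBasis hb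
      have hbn := TopologicalSpace.nonempty_of_mem_countableBasis hb
      have himg : {x | ∃ y ∈ b, (x, y) ∈ t} = Prod.fst '' (t ∩ univ ×ˢ b) := by
        ext x; simp [and_comm]
      refine residual_of_dense_open (s := {x | ∃ y ∈ b, (x, y) ∈ t}) ?_ ?_
      · rw [himg]
        exact isOpenMap_fst _ ((hSo t ht).inter (isOpen_univ.prod hbo))
      · rw [dense_iff_inter_open]
        rintro U hU hUn
        obtain ⟨⟨x, y⟩, ⟨hx, hy⟩, hxy⟩ :=
          (hSd t ht).inter_open_nonempty _ (hU.prod hbo) (hUn.prod hbn)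
        exact ⟨x, hx, y, hy, hxy⟩
    filter_upwards [(eventually_countable_ball (TopologicalSpace.countable_countableBasis β)).2 hB]
      with x hx
    refine residual_of_dense_open (s := {y | (x, y) ∈ t}) ((hSo t ht).preimage (by fun_prop)) ?_
    rw [(TopologicalSpace.isBasis_countableBasis β).dense_iff]
    intro b hb _
    obtain ⟨y, hy, hyt⟩ := hx b hb
    exact ⟨y, hy, hyt⟩
  filter_upwards [(eventually_countable_ball hSc).2 key] with x hx
  filter_upwards [(eventually_countable_ball hSc).2 hx] with y hy
  exact hSs hy

theorem Set.Countable.isMeagre {β : Type*} [TopologicalSpace β] [T1Space β] [PerfectSpace β]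
    {s : Set β} (hs : s.Countable) : IsMeagre s := by
  rw [← biUnion_of_singleton s]
  refine isMeagre_biUnion hs fun x _ => IsNowhereDense.isMeagre ?_
  rw [isClosed_singleton.isNowhereDense_iff]
  exact interior_singleton x

theorem MeasurableSet.isMeagre_of_countable_sections {α β : Type*} [TopologicalSpace α]
    [TopologicalSpace β] [SecondCountableTopology β] [BaireSpace α] [BaireSpace β] [T1Space β]
    [PerfectSpace β] [MeasurableSpace (α × β)] [BorelSpace (α × β)] {s : Set (α × β)}
    (hs : MeasurableSet s) (hc : ∀ x, {y | (x, y) ∈ s}.Countable) : IsMeagre s := by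
  obtain ⟨u, hu, hsu⟩ := hs.residualEq_isOpen
  obtain rfl | ⟨⟨a, b⟩, hab⟩ := u.eq_empty_or_nonempty
  · filter_upwards [hsu] with p hp hps
    exact (iff_of_eq hp).1 hps
  obtain ⟨U, V, hU, hV, haU, hbV, hUV⟩ := isOpen_prod_iff.1 hu a b hab
  obtain ⟨x, hxU, hx⟩ := (dense_of_mem_residual
    (eventually_residual_of_mem_residual_prod (s := {p | s p = u p}) hsu)).inter_open_nonempty
      U hU ⟨a, haU⟩
  have hm : ∀ᶠ y in residual β, y ∉ {y | (x, y) ∈ s} := (hc x).isMeagre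
  obtain ⟨y, hyV, hy⟩ := (dense_of_mem_residual (hm.and hx)).inter_open_nonempty V hV ⟨b, hbV⟩
  have h2 : s (x, y) = u (x, y) := hy.2
  exact (hy.1 ((iff_of_eq h2).2 (hUV ⟨hxU, hyV⟩))).elim

instance : PerfectSpace (ℕ → Bool) := by
  rw [perfectSpace_iff_forall_not_isolated]
  intro x
  rw [← mem_closure_iff_nhdsWithin_neBot]
  have hlim : Tendsto (fun n : ℕ => Function.update x n (!x n)) atTop (𝓝 x) := by
    rw [tendsto_pi_nhds]
    intro i
    refine tendsto_const_nhds.congr' ?_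
    filter_upwards [eventually_gt_atTop i] with n hn
    rw [Function.update_of_ne hn.ne]
  refine mem_closure_of_tendsto hlim (Eventually.of_forall fun n hn => ?_)
  have := congrFun hn n
  simp at this

/-- Close approximation of a continuous map by one depending on finitely many coordinates. -/
theorem ContinuousMap.exists_forall_agree_dist_lt {β : Type*} [PseudoMetricSpace β]
    (k : C(ℕ → Bool, β)) {ε : ℝ} (hε : 0 < ε) :
    ∃ N, ∀ z w : ℕ → Bool, (∀ i < N, z i = w i) → dist (k z) (k w) < ε := by
  let : MetricSpace (ℕ → Bool) := PiNat.metricSpaceOfDiscreteUniformity fun _ => rfl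
  obtain ⟨δ, hδ, h⟩ := Metric.uniformContinuous_iff.1
    (CompactSpace.uniformContinuous_of_continuous k.continuous) ε hε
  obtain ⟨N, hN⟩ := exists_pow_lt_of_lt_one hδ (by norm_num : (1 / 2 : ℝ) < 1)
  refine ⟨N, fun z w hzw => h (lt_of_le_of_lt ?_ hN)⟩
  exact PiNat.mem_cylinder_iff_dist_le.1 (PiNat.mem_cylinder_iff.2 hzw)

theorem dense_setOf_forall_pair_mem {ι β : Type*} [Finite ι] [TopologicalSpace β]
    {O : Set (β × β)} (ho : IsOpen O) (hd : Dense O) :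
    Dense {c : ι → β | ∀ s t, s ≠ t → (c s, c t) ∈ O} := by
  classical
  have : {c : ι → β | ∀ s t, s ≠ t → (c s, c t) ∈ O} =
      ⋂ p ∈ {p : ι × ι | p.1 ≠ p.2}, (fun c : ι → β => (c p.1, c p.2)) ⁻¹' O := by
    ext c; simp
  rw [this]
  have hcont (p : ι × ι) : Continuous fun c : ι → β => (c p.1, c p.2) := by fun_prop
  have hopen (p : ι × ι) (hp : p.1 ≠ p.2) : IsOpenMap fun c : ι → β => (c p.1, c p.2) := by
    rw [isOpenMap_iff_nhds_le]
    intro c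
    have : 𝓝 (c p.1, c p.2) ≤ Filter.map (fun q : β × β => ((fun c : ι → β => (c p.1, c p.2))
        (Function.update (Function.update c p.1 q.1) p.2 q.2))) (𝓝 (c p.1, c p.2)) := by
      simp [Function.update_of_ne hp]
    refine this.trans ?_
    change Filter.map ((fun c : ι → β => (c p.1, c p.2)) ∘ _) _ ≤ _
    rw [← Filter.map_map]
    refine Filter.map_mono ?_
    have hcu : Continuous fun q : β × β =>
      Function.update (Function.update c p.1 q.1) p.2 q.2 := by fun_prop
    simpa [Tendsto] using hcu.tendsto (c p.1, c p.2)
  have hfin : {p : ι × ι | p.1 ≠ p.2}.Finite := Set.toFinite _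
  have key : ∀ F : Set (ι × ι), F.Finite → F ⊆ {p | p.1 ≠ p.2} →
      Dense (⋂ p ∈ F, (fun c : ι → β => (c p.1, c p.2)) ⁻¹' O) := by
    intro F hF
    induction F, hF using Set.Finite.induction_on with
    | empty => simp
    | @insert p F hp hF ih =>
      intro hsub
      rw [biInter_insert]
      refine (hd.preimage (hopen p (hsub (mem_insert _ _)))).inter_of_isOpen_left
        (ih ((subset_insert _ _).trans hsub)) (ho.preimage (hcont p))
  exact key _ hfin subset_rfl

theorem ContinuousMap.isOpen_and_dense_setOf_pair_mem {β : Type*} [MetricSpace β]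
    {O : Set (β × β)} (ho : IsOpen O) (hd : Dense O) (n : ℕ) :
    IsOpen {k : C(ℕ → Bool, β) | ∀ z w, z n ≠ w n → (k z, k w) ∈ O} ∧
      Dense {k : C(ℕ → Bool, β) | ∀ z w, z n ≠ w n → (k z, k w) ∈ O} := by
  constructor
  · have hK : IsCompact {p : (ℕ → Bool) × (ℕ → Bool) | p.1 n ≠ p.2 n} := by
      refine IsClosed.isCompact ?_
      have : Continuous fun p : (ℕ → Bool) × (ℕ → Bool) => (p.1 n, p.2 n) := by fun_prop
      exact (isClosed_discrete {q : Bool × Bool | q.1 ≠ q.2}).preimage this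
    have hc : Continuous fun k : C(ℕ → Bool, β) => k.prodMap k :=
      ContinuousMap.continuous_of_continuous_uncurry _ <| by
        change Continuous fun p : C(ℕ → Bool, β) × (ℕ → Bool) × (ℕ → Bool) =>
          (p.1 p.2.1, p.1 p.2.2)
        fun_prop
    convert (ContinuousMap.isOpen_setOfPred_mapsTo hK ho).preimage hc using 1
    ext k
    simp [MapsTo]
  · rw [Metric.dense_iff]
    intro k₀ ε hε
    obtain ⟨N, hN⟩ := k₀.exists_forall_agree_dist_lt (half_pos (half_pos hε))
    let M := max N (n + 1)
    let pad : (Fin M → Bool) → ℕ → Bool := fun s i => if h : i < M then s ⟨i, h⟩ else false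
    let res : (ℕ → Bool) → Fin M → Bool := fun z i => z i
    have hres : Continuous res := by fun_prop
    obtain ⟨c, hc, hcO⟩ := (dense_setOf_forall_pair_mem (ι := Fin M → Bool)
      ho hd).inter_open_nonempty
      (Set.univ.pi fun s => Metric.ball (k₀ (pad s)) (ε / 2 / 2))
      (isOpen_set_pi finite_univ fun _ _ => Metric.isOpen_ball)
      ⟨fun s => k₀ (pad s), fun s _ => Metric.mem_ball_self (by positivity)⟩
    refine ⟨⟨fun z => c (res z), (continuous_of_discreteTopology (f := c)).comp hres⟩, ?_, ?_⟩
    · rw [Metric.mem_ball]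
      refine lt_of_le_of_lt ((ContinuousMap.dist_le (half_pos hε).le).2 fun z => ?_)
        (half_lt_self hε)
      have h1 : dist (c (res z)) (k₀ (pad (res z))) < ε / 2 / 2 := hc (res z) trivial
      have h2 : dist (k₀ (pad (res z))) (k₀ z) < ε / 2 / 2 := by
        refine hN _ _ fun i hi => ?_
        have : i < M := lt_of_lt_of_le hi (le_max_left _ _)
        simp [pad, res, this]
      have := dist_triangle (c (res z)) (k₀ (pad (res z))) (k₀ z)
      simp only [ContinuousMap.coe_mk]
      linarith
    · intro z w hzw
      refine hcO _ _ fun h => hzw ?_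
      exact congrFun h ⟨n, lt_of_lt_of_le n.lt_succ_self (le_max_right _ _)⟩

theorem IsMeagre.exists_continuousMap_pair_notMem {β : Type*} [TopologicalSpace β]
    [TopologicalSpace.IsCompletelyMetrizableSpace β]
    [Nonempty β] {S : Set (β × β)} (hS : IsMeagre S) :
    ∃ k : C(ℕ → Bool, β), ∀ z w, z ≠ w → (k z, k w) ∉ S := by
  let := TopologicalSpace.upgradeIsCompletelyMetrizable β
  obtain ⟨T, hTo, hTd, hTc, hTs⟩ := mem_residual_iff.1 hS
  have := hTc.to_subtype
  have : Nonempty C(ℕ → Bool, β) := .map (ContinuousMap.const _) ‹_›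
  obtain ⟨k, hk⟩ := (dense_iInter_of_isOpen (f := fun p : T × ℕ =>
      {k : C(ℕ → Bool, β) | ∀ z w, z p.2 ≠ w p.2 → (k z, k w) ∈ p.1.1})
    (fun p => (ContinuousMap.isOpen_and_dense_setOf_pair_mem (hTo _ p.1.2) (hTd _ p.1.2) p.2).1)
    (fun p => (ContinuousMap.isOpen_and_dense_setOf_pair_mem (hTo _ p.1.2) (hTd _ p.1.2)
      p.2).2)).nonempty
  refine ⟨k, fun z w hzw => hTs fun t ht => ?_⟩
  obtain ⟨n, hn⟩ := Function.ne_iff.1 hzw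
  exact mem_iInter.1 hk (⟨t, ht⟩, n) z w hn

/-- The relation obtained from `R` by making all elements of each set `B p` equivalent. -/
def glue {α ι : Type*} (R : α → α → Prop) (B : ι → α → Prop) (x y : α) : Prop :=
  R x y ∨ ∃ p, B p x ∧ B p y

section Glue

variable {α ι : Type*} {R : α → α → Prop} {B : ι → α → Prop}

theorem glue_equivalence (hR : Equivalence R) (hinv : ∀ p x y, R x y → B p x → B p y)
    (huniq : ∀ p q x, B p x → B q x → p = q) : Equivalence (glue R B) where
  refl x := .inl (hR.refl x)
  symm := by
    rintro x y (h | ⟨p, hx, hy⟩)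
    exacts [.inl (hR.symm h), .inr ⟨p, hy, hx⟩]
  trans := by
    rintro x y z (h | ⟨p, hx, hy⟩) (h' | ⟨q, hy', hz⟩)
    · exact .inl (hR.trans h h')
    · exact .inr ⟨q, hinv _ _ _ (hR.symm h) hy', hz⟩
    · exact .inr ⟨p, hx, hinv _ _ _ h' hy⟩
    · obtain rfl := huniq p q y hy hy'
      exact .inr ⟨p, hx, hz⟩

theorem countable_setOf_glue (hR : ∀ x, {y | R x y}.Countable) (hB : ∀ p, {y | B p y}.Countable)
    (huniq : ∀ p q x, B p x → B q x → p = q) (x : α) : {y | glue R B x y}.Countable := by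
  by_cases h : ∃ p, B p x
  · obtain ⟨p, hp⟩ := h
    refine ((hR x).union (hB p)).mono ?_
    rintro y (h | ⟨q, hq, hy⟩)
    · exact .inl h
    · obtain rfl := huniq p q x hp hq
      exact .inr hy
  · refine (hR x).mono ?_
    rintro y (h' | ⟨q, hq, -⟩)
    exacts [h', (h ⟨q, hq⟩).elim]

theorem measurableSet_setOf_glue [MeasurableSpace α] [StandardBorelSpace α] [MeasurableSpace ι]
    [StandardBorelSpace ι] (hR : MeasurableSet {p : α × α | R p.1 p.2})
    (hB : MeasurableSet {p : ι × α | B p.1 p.2}) (huniq : ∀ p q x, B p x → B q x → p = q) :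
    MeasurableSet {p : α × α | glue R B p.1 p.2} := by
  let T : Set (ι × α × α) := {q | B q.1 q.2.1 ∧ B q.1 q.2.2}
  have hT : MeasurableSet T :=
    (hB.preimage (f := fun q : ι × α × α => (q.1, q.2.1)) (by fun_prop)).inter
      (hB.preimage (f := fun q : ι × α × α => (q.1, q.2.2)) (by fun_prop))
  have hinj : InjOn Prod.snd T := by
    rintro ⟨p, x⟩ hp ⟨q, y⟩ hq (rfl : x = y)
    rw [huniq p q x.1 hp.1 hq.1]
  convert hR.union (hT.image_of_measurable_injOn measurable_snd hinj) using 1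
  ext ⟨x, y⟩
  simp [glue, T]

end Glue

theorem DBS.rel_of_iff {D E : Cantor → Cantor → Prop} (h : DBS D E) {u x y : Cantor}
    (hx : E u x) (hy : E u y) (hxy : D u x ↔ D u y) : D x y := by
  have := h.equivD
  by_cases hux : D u x
  · exact this.trans (this.symm hux) (hxy.1 hux)
  obtain ⟨v, -, -, hv⟩ := h.double u
  exact this.trans (this.symm ((hv x hx).resolve_left hux))
    ((hv y hy).resolve_left fun h' => hux (hxy.2 h'))

/-- The half with label `b` of the union of the `E`-classes of the points `h i z`, where
the `D`-class of `h i z` is labelled `ε i`. -/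
def bubbleSide {ι : Type*} (D E : Cantor → Cantor → Prop) (h : ι → Cantor → Cantor) (ε : ι → Bool)
    (p : Cantor × Bool) (x : Cantor) : Prop :=
  ∃ i, E (h i p.1) x ∧ (D (h i p.1) x ↔ p.2 = ε i)

/-- The union of the `E`-classes of the points `h i z`. -/
def bubble {ι : Type*} (E : Cantor → Cantor → Prop) (h : ι → Cantor → Cantor)
    (z x : Cantor) : Prop :=
  ∃ i, E (h i z) x

namespace DBS

variable {ι : Type*} {D E : Cantor → Cantor → Prop} {h : ι → Cantor → Cantor} {ε : ι → Bool}

theorem bubble_unique (H : DBS D E) (hE : ∀ i j z w, E (h i z) (h j w) → i = j ∧ z = w)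
    (z w x : Cantor) : bubble E h z x → bubble E h w x → z = w := by
  rintro ⟨i, hi⟩ ⟨j, hj⟩
  exact (hE i j z w (H.equivE.trans hi (H.equivE.symm hj))).2

theorem bubbleSide_unique (H : DBS D E) (hE : ∀ i j z w, E (h i z) (h j w) → i = j ∧ z = w)
    (p q : Cantor × Bool) (x : Cantor) :
    bubbleSide D E h ε p x → bubbleSide D E h ε q x → p = q := by
  rintro ⟨i, hi, hi'⟩ ⟨j, hj, hj'⟩
  obtain ⟨z, b⟩ := p
  obtain ⟨w, c⟩ := q
  obtain ⟨rfl, rfl⟩ := hE i j z w (H.equivE.trans hi (H.equivE.symm hj))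
  have : b = ε i ↔ c = ε i := hi'.symm.trans hj'
  congr 1
  revert this
  cases b <;> cases c <;> cases ε i <;> simp

theorem bubble_of_rel (H : DBS D E) (z x y : Cantor) (hxy : E x y) :
    bubble E h z x → bubble E h z y := by
  rintro ⟨i, hi⟩
  exact ⟨i, H.equivE.trans hi hxy⟩

theorem bubbleSide_of_rel (H : DBS D E) (p : Cantor × Bool) (x y : Cantor) (hxy : D x y) :
    bubbleSide D E h ε p x → bubbleSide D E h ε p y := by
  rintro ⟨i, hi, hi'⟩
  refine ⟨i, H.equivE.trans hi (H.sub _ _ hxy), Iff.trans ⟨fun hy => ?_, fun hx => ?_⟩ hi'⟩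
  · exact H.equivD.trans hy (H.equivD.symm hxy)
  · exact H.equivD.trans hx hxy

theorem exists_bubbleSide_of_not_rel (H : DBS D E) {z x y u : Cantor}
    (hx : bubble E h z x) (hu : bubble E h z u) (hxy : E x y) (hDxy : ¬ D x y) :
    (∃ p, bubbleSide D E h ε p x ∧ bubbleSide D E h ε p u) ∨
      ∃ p, bubbleSide D E h ε p y ∧ bubbleSide D E h ε p u := by
  have key : ∀ v, bubble E h z v → ∃ b, bubbleSide D E h ε (z, b) v := by
    rintro v ⟨i, hi⟩
    by_cases hv : D (h i z) v
    · exact ⟨ε i, i, hi, by simpa using hv⟩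
    · exact ⟨!ε i, i, hi, by simpa using hv⟩
  obtain ⟨i, hi⟩ := hx
  obtain ⟨b, hb⟩ := key u hu
  have hiy := H.equivE.trans hi hxy
  have hne : ¬ (D (h i z) x ↔ D (h i z) y) := fun h' => hDxy (H.rel_of_iff hi hiy h')
  by_cases hbx : D (h i z) x ↔ b = ε i
  · exact .inl ⟨(z, b), ⟨i, hi, hbx⟩, hb⟩
  · exact .inr ⟨(z, b), ⟨i, hiy, by dsimp only; tauto⟩, hb⟩

theorem rel_of_glue_bubbleSide (H : DBS D E)
    (hE : ∀ i j z w, E (h i z) (h j w) → i = j ∧ z = w) {x y : Cantor} (hxy : E x y)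
    (hg : glue D (bubbleSide D E h ε) x y) : D x y := by
  obtain hD | ⟨⟨z, b⟩, ⟨i, hi, hi'⟩, ⟨j, hj, hj'⟩⟩ := hg
  · exact hD
  obtain ⟨rfl, -⟩ := hE i j z z (H.equivE.trans hi (H.equivE.trans hxy (H.equivE.symm hj)))
  exact H.rel_of_iff hi hj (hi'.trans hj'.symm)

theorem dbsle_glue (H : DBS D E) (hE : ∀ i j z w, E (h i z) (h j w) → i = j ∧ z = w) :
    DBSle D E (glue D (bubbleSide D E h ε)) (glue E (bubble E h)) :=
  ⟨fun _ _ => .inl, fun _ _ => .inl, fun _ _ hxy hD hg => hD (H.rel_of_glue_bubbleSide hE hxy hg)⟩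

/-- Amalgamating, for each `z`, the `E`-classes of the points `h i z` yields a DBS. -/
theorem glue_bubble [Countable ι] (H : DBS D E) (hm : ∀ i, Measurable (h i))
    (hE : ∀ i j z w, E (h i z) (h j w) → i = j ∧ z = w) :
    DBS (glue D (bubbleSide D E h ε)) (glue E (bubble E h)) where
  equivD := glue_equivalence H.equivD H.bubbleSide_of_rel (H.bubbleSide_unique hE)
  equivE := glue_equivalence H.equivE H.bubble_of_rel (H.bubble_unique hE)
  borelD := by
    refine measurableSet_setOf_glue H.borelD ?_ (H.bubbleSide_unique hE)
    have hpair (i : ι) : Measurable fun q : (Cantor × Bool) × Cantor => (h i q.1.1, q.2) :=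
      ((hm i).comp (by fun_prop)).prodMk (by fun_prop)
    refine measurableSet_setOfPred.2 (Measurable.exists fun i =>
      Measurable.and ?_ (Measurable.iff ?_ ?_))
    · exact measurableSet_setOfPred.1 (H.borelE.preimage (hpair i))
    · exact measurableSet_setOfPred.1 (H.borelD.preimage (hpair i))
    · exact measurableSet_setOfPred.1 ((measurableSet_singleton (ε i)).preimage
        (by fun_prop : Measurable fun q : (Cantor × Bool) × Cantor => q.1.2))
  borelE := by
    refine measurableSet_setOf_glue H.borelE ?_ (H.bubble_unique hE)
    have hpair (i : ι) : Measurable fun q : Cantor × Cantor => (h i q.1, q.2) :=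
      ((hm i).comp (by fun_prop)).prodMk (by fun_prop)
    exact measurableSet_setOfPred.2 (Measurable.exists fun i =>
      measurableSet_setOfPred.1 (H.borelE.preimage (hpair i)))
  countableD := by
    refine countable_setOf_glue H.countableD (fun p => ?_) (H.bubbleSide_unique hE)
    refine (countable_iUnion fun i => H.countableE (h i p.1)).mono ?_
    rintro y ⟨i, hi, -⟩
    exact mem_iUnion.2 ⟨i, hi⟩
  countableE := by
    refine countable_setOf_glue H.countableE (fun p => ?_) (H.bubble_unique hE)
    refine (countable_iUnion fun i => H.countableE (h i p)).mono ?_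
    rintro y ⟨i, hi⟩
    exact mem_iUnion.2 ⟨i, hi⟩
  sub := by
    rintro x y (hD | ⟨p, ⟨i, hi, -⟩, ⟨j, hj, -⟩⟩)
    exacts [.inl (H.sub _ _ hD), .inr ⟨p.1, ⟨i, hi⟩, ⟨j, hj⟩⟩]
  double x := by
    obtain ⟨y, hxy, hDxy, hy⟩ := H.double x
    refine ⟨y, .inl hxy, fun hg => hDxy (H.rel_of_glue_bubbleSide hE hxy hg), ?_⟩
    rintro u (hu | ⟨z, hx, hu⟩)
    · exact (hy u hu).imp .inl .inl
    · exact (H.exists_bubbleSide_of_not_rel hx hu hxy hDxy).imp .inr .inr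

theorem bubbleSide_self (H : DBS D E) (i : ι) (z : Cantor) :
    bubbleSide D E h ε (z, ε i) (h i z) :=
  ⟨i, H.equivE.refl _, by simpa using H.equivD.refl _⟩

theorem isMeagre_setOf_rel (H : DBS D E) {a b : Cantor → Cantor} (ha : Measurable a)
    (hb : Measurable b) (hbi : Function.Injective b) :
    IsMeagre {p : Cantor × Cantor | E (a p.1) (b p.2)} :=
  (H.borelE.preimage (f := fun p : Cantor × Cantor => (a p.1, b p.2))
    (by fun_prop)).isMeagre_of_countable_sections
    fun x => (H.countableE (a x)).preimage hbi

/-- Families of points on perfect sets that are pairwise inequivalent. -/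
theorem exists_continuous_pairwise_not_rel (H : DBS D E) {n : ℕ} {C : Fin n → Set Cantor}
    (hC : ∀ i, PerfectSet (C i)) :
    ∃ h : Fin n → Cantor → Cantor, (∀ i, Continuous (h i)) ∧ (∀ i z, h i z ∈ C i) ∧
      ∀ i j z w, E (h i z) (h j w) → i = j ∧ z = w := by
  have hφ : ∀ i, ∃ f : (ℕ → Bool) → Cantor,
      range f ⊆ C i ∧ Continuous f ∧ Function.Injective f := by
    intro i
    let := TopologicalSpace.upgradeIsCompletelyMetrizable Cantor
    exact (hC i).1.exists_nat_bool_injection (hC i).2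
  choose φ hφr hφc hφi using hφ
  have hmeagre : IsMeagre (⋃ i, ⋃ j, {p : Cantor × Cantor | E (φ i p.1) (φ j p.2)}) :=
    isMeagre_iUnion fun i => isMeagre_iUnion fun j =>
      H.isMeagre_setOf_rel (hφc i).measurable (hφc j).measurable (hφi j)
  obtain ⟨k, hk⟩ := hmeagre.exists_continuousMap_pair_notMem
  let c : Fin n → Cantor → Cantor := fun i z m => if m < n then decide (m = i) else z (m - n)
  have hc : ∀ i, Continuous (c i) := fun i => continuous_pi fun m => by
    by_cases hm : m < n
    · simpa [c, hm] using continuous_const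
    · simpa [c, hm] using continuous_apply _
  refine ⟨fun i z => φ i (k (c i z)), fun i => (hφc i).comp (k.continuous.comp (hc i)),
    fun i z => hφr i ⟨_, rfl⟩, fun i j z w hE => ?_⟩
  have hcc : c i z = c j w := by
    by_contra hne
    exact hk _ _ hne (mem_iUnion₂.2 ⟨i, j, hE⟩)
  constructor
  · have := congrFun hcc i
    simpa [c, Fin.val_inj] using this
  · ext m
    have := congrFun hcc (m + n)
    simp [c] at this
    rw [this]

end DBS

theorem PerfectSet.range {h : Cantor → Cantor} (hc : Continuous h) (hi : Function.Injective h) :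
    PerfectSet (range h) := by
  refine ⟨⟨(isCompact_range hc).isClosed, ?_⟩, range_nonempty h⟩
  rw [preperfect_iff_nhds]
  rintro _ ⟨z, rfl⟩ U hU
  obtain ⟨w, ⟨hw, -⟩, hne⟩ := preperfect_iff_nhds.1 PerfectSpace.univ_preperfect z (mem_univ z) _
    (hc.continuousAt.preimage_mem_nhds hU)
  exact ⟨h w, ⟨hw, w, rfl⟩, hi.ne hne⟩

/-- Accommodation lemma, Sacks case, two maps: given a DBS `⟨D,E⟩` and perfect sets
`R, X`, there are a perfect `Y ⊆ X`, Borel injections `f, g : Y → R`, and a DBS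
`⟨D',E'⟩` extending `⟨D,E⟩` which positively accommodates `f` and negatively
accommodates `g`. -/
theorem accommodate_sacks_two (D E : Cantor → Cantor → Prop) (hDE : DBS D E)
    (R X : Set Cantor) (hR : PerfectSet R) (hX : PerfectSet X) :
    ∃ Y, Y ⊆ X ∧ PerfectSet Y ∧
      ∃ f g : Y → Cantor, Measurable f ∧ Measurable g ∧
        Function.Injective f ∧ Function.Injective g ∧
        (∀ y : Y, f y ∈ R) ∧ (∀ y : Y, g y ∈ R) ∧
        ∃ D' E', DBS D' E' ∧ DBSle D E D' E' ∧
          (∀ y : Y, D' (f y) ↑y) ∧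
          (∀ y : Y, E' (g y) ↑y ∧ ¬ D' (g y) ↑y) := by
  obtain ⟨h, hc, hmem, hE⟩ := hDE.exists_continuous_pairwise_not_rel
    (C := ![X, R, R]) (by simp [Fin.forall_fin_succ, hX, hR])
  have hinj (i : Fin 3) : Function.Injective (h i) := fun z w hzw =>
    (hE i i z w (hzw ▸ hDE.equivE.refl _)).2
  let e : Cantor ≃ₜ range (h 0) :=
    ((hc 0).isClosedEmbedding (hinj 0)).isEmbedding.toHomeomorph
  let ε : Fin 3 → Bool := ![true, true, false]
  have he (y : range (h 0)) : (y : Cantor) = h 0 (e.symm y) :=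
    congrArg Subtype.val (e.apply_symm_apply y).symm
  refine ⟨range (h 0), range_subset_iff.2 (hmem 0), PerfectSet.range (hc 0) (hinj 0),
    fun y => h 1 (e.symm y), fun y => h 2 (e.symm y),
    ((hc 1).comp e.symm.continuous).measurable, ((hc 2).comp e.symm.continuous).measurable,
    (hinj 1).comp e.symm.injective, (hinj 2).comp e.symm.injective,
    fun y => hmem 1 _, fun y => hmem 2 _, _, _,
    hDE.glue_bubble (ε := ε) (fun i => (hc i).measurable) hE, hDE.dbsle_glue hE, ?_, ?_⟩
  · intro y
    rw [he y]
    exact .inr ⟨(e.symm y, true), hDE.bubbleSide_self (ε := ε) 1 _,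
      hDE.bubbleSide_self (ε := ε) 0 _⟩
  · intro y
    rw [he y]
    refine ⟨.inr ⟨e.symm y, ⟨2, hDE.equivE.refl _⟩, ⟨0, hDE.equivE.refl _⟩⟩, ?_⟩
    rintro (hD | ⟨p, h2, h0⟩)
    · exact absurd (hE _ _ _ _ (hDE.sub _ _ hD)).1 (by decide)
    · have h2' := hDE.bubbleSide_unique hE _ _ _ h2 (hDE.bubbleSide_self (ε := ε) 2 _)
      have h0' := hDE.bubbleSide_unique hE _ _ _ h0 (hDE.bubbleSide_self (ε := ε) 0 _)
      simpa [ε] using congrArg Prod.snd (h2'.symm.trans h0')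
end
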